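/- Let n ≥ 3, let 0 ∈ U ⊆ ℝ be open with B(0, r̄) ⊆ U for some r̄ > 0, let f, g : U × U → (0, ∞) be C¹ functions with f(0,0) = g(0,0) = 1, and fix λ > 0. Then for every δ > 0 there exists ε₀ > 0 (depending on n, f, g, λ, δ) such that the following holds: for every smooth u : S^{n-1} → (−1, ∞) with ‖u‖_{C¹(S^{n-1})} ≤ ε for some ε < min(ε₀, r̄), writing u = u₁ + u₂ where u₁ and u₂ are the L² projections of u onto the spans of the eigenfunctions of −Δ on S^{n-1} with eigenvalue at most λ and greater than λ respectively, one has ∫_{S^{n-1}} f(u, |∇u|²) ∇²u[∇u, ∇u] ≥ −(1/2) ∫_{S^{n-1}} div(g(u, |∇u|²)∇u) |∇u₂|² − δ ( ∫_{S^{n-1}} |div(g(u, |∇u|²)∇u)| · |∇u₂|² + ∫_{S^{n-1}} ( [div(g(u, |∇u|²)∇u)]⁺ + 1 ) |∇u|² ). -/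

import Mathlib

open MeasureTheory Metric Set Real
open scoped ENNReal RealInnerProductSpace

noncomputable section

abbrev Euc (n : ℕ) := EuclideanSpace ℝ (Fin n)

/-- Divergence of a vector field on Euclidean space: trace of its Fréchet derivative.
For a vector field which is tangent to the unit sphere and homogeneous along rays, this
coincides on the sphere with the divergence on the sphere. -/
def divg {n : ℕ} (W : Euc n → Euc n) (x : Euc n) : ℝ :=
  LinearMap.trace ℝ (Euc n) (fderiv ℝ W x).toLinearMap

/-- Laplacian (trace of the Hessian). For a `0`-homogeneous function this coincides on the
unit sphere with the Laplace–Beltrami operator of the sphere. -/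
def lapl {n : ℕ} (u : Euc n → ℝ) (x : Euc n) : ℝ := divg (gradient u) x

/-- The Hessian of `u` as a bilinear form: `hessBil u x X Y = D²u(x)[X, Y]`. For a
`0`-homogeneous `u` and `X, Y` tangent to the unit sphere at `x`, this coincides with the
covariant Hessian of `u` on the sphere. -/
def hessBil {n : ℕ} (u : Euc n → ℝ) (x X Y : Euc n) : ℝ :=
  ⟪fderiv ℝ (gradient u) x X, Y⟫

/-- A smooth function on the unit sphere `S^{n-1}`, encoded as a `0`-homogeneous smooth
function on `ℝⁿ \ {0}`. For such a function, `gradient`, `hessBil`, `lapl` and `divg`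
coincide on `S^{n-1}` with the corresponding intrinsic operators of the sphere. -/
def IsSphereFun {n : ℕ} (u : Euc n → ℝ) : Prop :=
  ContDiffOn ℝ (⊤ : ℕ∞) u {x : Euc n | x ≠ 0} ∧
    ∀ x : Euc n, x ≠ 0 → ∀ t : ℝ, 0 < t → u (t • x) = u x

/-- `φ` is an eigenfunction of `−Δ` on `S^{n-1}` with eigenvalue `μ` (as usual, encoded
through its `0`-homogeneous extension, whose Euclidean Laplacian agrees on the sphere with
the Laplace–Beltrami operator). -/
def IsSphereEigenfun {n : ℕ} (φ : Euc n → ℝ) (μ : ℝ) : Prop :=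
  IsSphereFun φ ∧ ∀ x ∈ sphere (0 : Euc n) 1, lapl φ x = -μ * φ x

/-- `u₁` belongs to the span of the eigenfunctions of `−Δ` on `S^{n-1}` with eigenvalue at
most `lam`. -/
def IsLowFrequency {n : ℕ} (lam : ℝ) (u₁ : Euc n → ℝ) : Prop :=
  ∃ (N : ℕ) (φ : Fin N → Euc n → ℝ) (μ : Fin N → ℝ) (c : Fin N → ℝ),
    (∀ i, IsSphereEigenfun (φ i) (μ i) ∧ μ i ≤ lam) ∧
      ∀ x : Euc n, x ≠ 0 → u₁ x = ∑ i, c i * φ i x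

/-- `u₂` is `L²(S^{n-1})`-orthogonal to every eigenfunction of `−Δ` with eigenvalue at most
`lam`, i.e. it belongs to the span of the eigenfunctions with eigenvalue greater
than `lam`. -/
def IsHighFrequency {n : ℕ} (lam : ℝ) (u₂ : Euc n → ℝ) : Prop :=
  ∀ (φ : Euc n → ℝ) (μ : ℝ), IsSphereEigenfun φ μ → μ ≤ lam →
    (∫ x in sphere (0 : Euc n) 1, u₂ x * φ x ∂μH[(n : ℝ) - 1]) = 0

/-- A finite measure carried by the unit sphere and invariant under linear isometries. -/
structure IsSphereMeasure {n : ℕ} (ν : Measure (Euc n)) : Prop where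
  finite : IsFiniteMeasure ν
  ae_mem : ∀ᵐ x ∂ν, x ∈ sphere (0 : Euc n) 1
  invariant : ∀ e : Euc n ≃ₗᵢ[ℝ] Euc n, MeasurePreserving e ν ν

/-- The point of `ℝ^{m+1}` with `i`-th coordinate `s` and remaining coordinates `y`. -/
def insertCoord {m : ℕ} (i : Fin (m + 1)) (s : ℝ) (y : Fin m → ℝ) : Euc (m + 1) :=
  WithLp.toLp 2 (i.insertNth s y)

lemma contDiff_insertCoord {m : ℕ} (i : Fin (m + 1)) (s : ℝ) :
    ContDiff ℝ 1 (insertCoord i s) := by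
  rw [contDiff_euclidean]
  intro j
  rcases Fin.eq_self_or_eq_succAbove i j with rfl | ⟨k, rfl⟩
  · simpa [insertCoord] using contDiff_const
  · simpa [insertCoord] using contDiff_apply ℝ ℝ k

lemma insertCoord_ne_zero {m : ℕ} (i : Fin (m + 1)) {s : ℝ} (hs : s ≠ 0) (y : Fin m → ℝ) :
    insertCoord i s y ≠ 0 := by
  intro h
  apply hs
  have := congrArg (fun z : Euc (m + 1) => z i) h
  simpa [insertCoord] using this

lemma hausdorffMeasure_image_cube_lt_top {m : ℕ} (i : Fin (m + 1)) {s : ℝ} (hs : s ≠ 0) :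
    μH[(m : ℝ)] ((fun y => ‖insertCoord i s y‖⁻¹ • insertCoord i s y) ''
      Icc (-1 : Fin m → ℝ) 1) < ∞ := by
  have hc : ContDiff ℝ 1 (fun y => ‖insertCoord i s y‖⁻¹ • insertCoord i s y) :=
    (((contDiff_insertCoord i s).norm ℝ (insertCoord_ne_zero i hs)).inv
      (fun y => norm_ne_zero_iff.2 (insertCoord_ne_zero i hs y))).smul (contDiff_insertCoord i s)
  obtain ⟨K, hK⟩ := (hc.contDiffOn (s := Icc (-1 : Fin m → ℝ) 1)).exists_lipschitzOnWith
    one_ne_zero (convex_Icc _ _) isCompact_Icc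
  refine (hK.hausdorffMeasure_image_le (Nat.cast_nonneg m)).trans_lt ?_
  have h := @hausdorffMeasure_pi_real (Fin m) _
  rw [Fintype.card_fin] at h
  rw [h]
  exact ENNReal.mul_lt_top (by simp) isCompact_Icc.measure_lt_top

lemma sphere_subset_iUnion_image_cube {m : ℕ} :
    sphere (0 : Euc (m + 1)) 1 ⊆ ⋃ i : Fin (m + 1), ⋃ s ∈ ({1, -1} : Set ℝ),
      (fun y => ‖insertCoord i s y‖⁻¹ • insertCoord i s y) '' Icc (-1 : Fin m → ℝ) 1 := by
  intro x hx
  have hx1 : ‖x‖ = 1 := by simpa using hx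
  obtain ⟨i, hi⟩ := Finite.exists_max (fun j => |x j|)
  have hi0 : 0 < |x i| := by
    by_contra! h
    have : x = 0 := by
      ext j
      exact abs_nonpos_iff.1 ((hi j).trans h)
    simp [this] at hx1
  have key : insertCoord i (x i / |x i|) (fun k => x (i.succAbove k) / |x i|) =
      |x i|⁻¹ • x := by
    ext j
    rcases Fin.eq_self_or_eq_succAbove i j with rfl | ⟨k, rfl⟩ <;>
      simp [insertCoord, div_eq_inv_mul]
  simp only [mem_iUnion]
  refine ⟨i, x i / |x i|, ?_, fun k => x (i.succAbove k) / |x i|, ?_, ?_⟩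
  · rcases le_or_gt 0 (x i) with h | h
    · left; rw [abs_of_nonneg h] at hi0 ⊢; exact div_self hi0.ne'
    · right; rw [abs_of_neg h, div_neg, div_self h.ne]; rfl
  · constructor <;> intro k
    · have := (abs_le.1 (hi (i.succAbove k))).1
      simpa [le_div_iff₀ hi0] using this
    · have := (abs_le.1 (hi (i.succAbove k))).2
      simpa [div_le_iff₀ hi0] using this
  · simp only [key, norm_smul, hx1, norm_inv, norm_eq_abs, abs_abs, mul_one, inv_inv, smul_smul]
    rw [mul_inv_cancel₀ hi0.ne', one_smul]

lemma hausdorffMeasure_sphere_lt_top {m : ℕ} :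
    μH[(m : ℝ)] (sphere (0 : Euc (m + 1)) 1) < ∞ := by
  refine (measure_mono sphere_subset_iUnion_image_cube).trans_lt ?_
  refine (measure_iUnion_fintype_le _ _).trans_lt (ENNReal.sum_lt_top.2 fun i _ => ?_)
  refine measure_biUnion_lt_top (by simp) fun s hs => hausdorffMeasure_image_cube_lt_top i ?_
  rcases hs with rfl | rfl <;> norm_num

lemma isSphereMeasure_hausdorff {n : ℕ} (hn : 1 ≤ n) :
    IsSphereMeasure ((μH[(n : ℝ) - 1] : Measure (Euc n)).restrict (sphere 0 1)) := by
  obtain ⟨m, rfl⟩ : ∃ m, n = m + 1 := ⟨n - 1, by omega⟩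
  have hm : ((m + 1 : ℕ) : ℝ) - 1 = m := by push_cast; ring
  rw [hm]
  refine ⟨⟨?_⟩, ae_restrict_mem isClosed_sphere.measurableSet, fun e => ?_⟩
  · rw [Measure.restrict_apply_univ]
    exact hausdorffMeasure_sphere_lt_top
  · have h := (e.toIsometryEquiv.measurePreserving_hausdorffMeasure (m : ℝ)).restrict_preimage
      (s := sphere 0 1) isClosed_sphere.measurableSet
    have h2 : (e.toIsometryEquiv ⁻¹' sphere 0 1 : Set (Euc (m + 1))) = sphere 0 1 := by
      ext x; simp
    rw [h2] at h
    exact h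

namespace IsSphereMeasure

variable {n : ℕ} {ν : Measure (Euc n)}

lemma integrable (hν : IsSphereMeasure ν) {F : Euc n → ℝ}
    (hF : ContinuousOn F (sphere 0 1)) : Integrable F ν := by
  have := hν.finite
  rw [← Measure.restrict_eq_self_of_ae_mem hν.ae_mem]
  exact hF.integrableOn_compact (isCompact_sphere 0 1)

lemma integral_mono (hν : IsSphereMeasure ν) {F G : Euc n → ℝ}
    (hF : ContinuousOn F (sphere 0 1)) (hG : ContinuousOn G (sphere 0 1))
    (h : ∀ x ∈ sphere (0 : Euc n) 1, F x ≤ G x) : ∫ x, F x ∂ν ≤ ∫ x, G x ∂ν :=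
  integral_mono_ae (hν.integrable hF) (hν.integrable hG) (hν.ae_mem.mono h)

lemma integral_congr (hν : IsSphereMeasure ν) {F G : Euc n → ℝ}
    (h : ∀ x ∈ sphere (0 : Euc n) 1, F x = G x) : ∫ x, F x ∂ν = ∫ x, G x ∂ν :=
  integral_congr_ae (hν.ae_mem.mono h)

lemma abs_integral_le (hν : IsSphereMeasure ν) {F G : Euc n → ℝ}
    (hF : ContinuousOn F (sphere 0 1)) (hG : ContinuousOn G (sphere 0 1))
    (h : ∀ x ∈ sphere (0 : Euc n) 1, |F x| ≤ G x) : |∫ x, F x ∂ν| ≤ ∫ x, G x ∂ν :=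
  (abs_integral_le_integral_abs).trans (hν.integral_mono hF.abs hG h)

/-- Infinitesimal form of rotation invariance. -/
lemma integral_fderiv_skew (hν : IsSphereMeasure ν) {A : Euc n →L[ℝ] Euc n}
    (hA : A ∈ skewAdjoint (Euc n →L[ℝ] Euc n)) {φ : Euc n → ℝ}
    (hφ : ∀ x ∈ sphere (0 : Euc n) 1, DifferentiableAt ℝ φ x)
    (hφ' : ContinuousOn (fderiv ℝ φ) (sphere 0 1)) :
    ∫ x, fderiv ℝ φ x (A x) ∂ν = 0 := by
  have hfin := hν.finite
  let _ : NormedAlgebra ℚ (Euc n →L[ℝ] Euc n) := NormedAlgebra.restrictScalars ℚ ℝ _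
  have hunit (t : ℝ) : NormedSpace.exp (t • A) ∈ unitary (Euc n →L[ℝ] Euc n) :=
    NormedSpace.exp_mem_unitary_of_mem_skewAdjoint (skewAdjoint.smul_mem t hA)
  let e (t : ℝ) : Euc n ≃ₗᵢ[ℝ] Euc n := Unitary.linearIsometryEquiv ⟨_, hunit t⟩
  have he (t : ℝ) (x : Euc n) : e t x = NormedSpace.exp (t • A) x := rfl
  have he0 (x : Euc n) : e 0 x = x := by
    have h0 : (0 : ℝ) • A = 0 := zero_smul ℝ A
    rw [he, h0, NormedSpace.exp_zero]; rfl
  have hmem (t : ℝ) {x : Euc n} (hx : x ∈ sphere (0 : Euc n) 1) : e t x ∈ sphere (0 : Euc n) 1 := by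
    simpa using hx
  have hder (t : ℝ) (x : Euc n) : HasDerivAt (fun t => e t x) (A (e t x)) t := by
    have := (hasDerivAt_exp_smul_const' A t).clm_apply (hasDerivAt_const t x)
    simpa [he] using this
  have hcont : ContinuousOn φ (sphere 0 1) := fun x hx =>
    (hφ x hx).continuousAt.continuousWithinAt
  have hint (t : ℝ) : ∫ x, φ (e t x) ∂ν = ∫ x, φ x ∂ν :=
    (hν.invariant (e t)).integral_comp (e t).toHomeomorph.measurableEmbedding φ
  have hcF : ContinuousOn (fun x => fderiv ℝ φ x (A x)) (sphere 0 1) :=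
    hφ'.clm_apply A.continuous.continuousOn
  obtain ⟨C, hC⟩ := (isCompact_sphere (0 : Euc n) 1).exists_bound_of_continuousOn hcF
  have key := hasDerivAt_integral_of_dominated_loc_of_deriv_le (μ := ν) (x₀ := (0 : ℝ))
    (F := fun t x => φ (e t x)) (F' := fun t x => fderiv ℝ φ (e t x) (A (e t x)))
    (bound := fun _ => C) (s := univ) Filter.univ_mem
    (Filter.Eventually.of_forall fun t => (hν.integrable (F := fun x => φ (e t x))
      (hcont.comp (e t).continuous.continuousOn fun x hx => hmem t hx)).aestronglyMeasurable)
    (by simpa only [he0] using hν.integrable hcont)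
    (by simpa only [he0] using (hν.integrable hcF).aestronglyMeasurable)
    (hν.ae_mem.mono fun x hx t _ => hC _ (hmem t hx)) (integrable_const C)
    (hν.ae_mem.mono fun x hx t _ =>
      (hφ _ (hmem t hx)).hasFDerivAt.comp_hasDerivAt t (hder t x))
  have h2 := key.2
  simp only [hint, he0] at h2
  exact h2.unique (hasDerivAt_const _ _)

end IsSphereMeasure

/-- The infinitesimal rotation `x ↦ xⱼ eᵢ - xᵢ eⱼ`. -/
def rotGen {n : ℕ} (i j : Fin n) : Euc n →L[ℝ] Euc n :=
  (EuclideanSpace.proj j).smulRight (EuclideanSpace.single i (1 : ℝ)) -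
    (EuclideanSpace.proj i).smulRight (EuclideanSpace.single j (1 : ℝ))

lemma rotGen_apply {n : ℕ} (i j : Fin n) (x : Euc n) :
    rotGen i j x = x j • EuclideanSpace.single i (1 : ℝ) - x i • EuclideanSpace.single j (1 : ℝ) :=
  rfl

lemma rotGen_mem_skewAdjoint {n : ℕ} (i j : Fin n) :
    rotGen i j ∈ skewAdjoint (Euc n →L[ℝ] Euc n) := by
  rw [skewAdjoint.mem_iff, ContinuousLinearMap.star_eq_adjoint, eq_comm,
    ContinuousLinearMap.eq_adjoint_iff]
  intro x y
  simp only [neg_apply, rotGen_apply, inner_neg_left, inner_sub_left,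
    inner_sub_right, inner_smul_left, inner_smul_right, EuclideanSpace.inner_single_left,
    EuclideanSpace.inner_single_right]
  simp
  ring

lemma divg_eq_sum {n : ℕ} (X : Euc n → Euc n) (x : Euc n) :
    divg X x = ∑ i, fderiv ℝ X x (EuclideanSpace.single i 1) i := by
  rw [divg, LinearMap.trace_eq_sum_inner _ (EuclideanSpace.basisFun (Fin n) ℝ)]
  simp [EuclideanSpace.inner_single_left]

lemma continuousOn_divg {n : ℕ} {X : Euc n → Euc n} {s : Set (Euc n)}
    (hX : ContinuousOn (fderiv ℝ X) s) : ContinuousOn (divg X) s := by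
  have : divg X = fun x => ∑ i, fderiv ℝ X x (EuclideanSpace.single i 1) i :=
    funext (divg_eq_sum X)
  rw [this]
  refine continuousOn_finsetSum _ fun i _ => ?_
  exact (EuclideanSpace.proj (𝕜 := ℝ) i).continuous.comp_continuousOn
    (hX.clm_apply continuousOn_const)

/-- For a field tangent to all spheres, the radial part of the radial derivative vanishes. -/
lemma inner_fderiv_self_of_tangent {n : ℕ} {X : Euc n → Euc n} {x : Euc n} (hx : x ≠ 0)
    (hX : DifferentiableAt ℝ X x) (ht : ∀ y : Euc n, y ≠ 0 → ⟪X y, y⟫ = 0) :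
    ⟪fderiv ℝ X x x, x⟫ = 0 := by
  have h1 : HasFDerivAt (fun y => ⟪X y, y⟫) (0 : Euc n →L[ℝ] ℝ) x := by
    refine (hasFDerivAt_const (0 : ℝ) x).congr_of_eventuallyEq ?_
    filter_upwards [isOpen_ne.mem_nhds hx] with y hy using ht y hy
  have h2 := hX.hasFDerivAt.inner ℝ (hasFDerivAt_id x)
  have h3 := congrArg (fun L => L x) (h1.unique h2)
  simp [ht x hx] at h3
  exact h3.symm

/-- The divergence theorem on the sphere. -/
lemma IsSphereMeasure.integral_divg {n : ℕ} {ν : Measure (Euc n)} (hν : IsSphereMeasure ν)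
    {X : Euc n → Euc n} (hX : ∀ x ∈ sphere (0 : Euc n) 1, DifferentiableAt ℝ X x)
    (hX' : ContinuousOn (fderiv ℝ X) (sphere 0 1))
    (ht : ∀ y : Euc n, y ≠ 0 → ⟪X y, y⟫ = 0) : ∫ x, divg X x ∂ν = 0 := by
  have hder (i j : Fin n) {x : Euc n} (hx : x ∈ sphere (0 : Euc n) 1) :
      HasFDerivAt (fun y => X y i * y j)
        (X x i • EuclideanSpace.proj j + x j • (EuclideanSpace.proj i).comp (fderiv ℝ X x)) x :=
    ((EuclideanSpace.proj (𝕜 := ℝ) i).hasFDerivAt.comp x (hX x hx).hasFDerivAt).mul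
      (EuclideanSpace.proj (𝕜 := ℝ) j).hasFDerivAt
  have hXc : ContinuousOn X (sphere 0 1) := fun x hx =>
    (hX x hx).continuousAt.continuousWithinAt
  have hcont (i j : Fin n) : ContinuousOn (fderiv ℝ (fun y => X y i * y j)) (sphere 0 1) := by
    refine ContinuousOn.congr ?_ fun x hx => (hder i j hx).fderiv
    refine ContinuousOn.add ?_ ?_
    · exact ((EuclideanSpace.proj (𝕜 := ℝ) i).continuous.comp_continuousOn hXc).smul
        continuousOn_const
    · exact (EuclideanSpace.proj (𝕜 := ℝ) j).continuous.continuousOn.smul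
        (continuousOn_const.clm_comp hX')
  have h0 (i j : Fin n) :
      ∫ x, fderiv ℝ (fun y => X y i * y j) x (rotGen i j x) ∂ν = 0 :=
    hν.integral_fderiv_skew (rotGen_mem_skewAdjoint i j)
      (fun x hx => (hder i j hx).differentiableAt) (hcont i j)
  have hsum : ∫ x, ∑ i, ∑ j, fderiv ℝ (fun y => X y i * y j) x (rotGen i j x) ∂ν = 0 := by
    have hi (i j : Fin n) : Integrable
        (fun x => fderiv ℝ (fun y => X y i * y j) x (rotGen i j x)) ν :=
      hν.integrable ((hcont i j).clm_apply (rotGen i j).continuous.continuousOn)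
    rw [integral_finsetSum _ fun i _ => integrable_finsetSum _ fun j _ => hi i j]
    refine Finset.sum_eq_zero fun i _ => ?_
    rw [integral_finsetSum _ fun j _ => hi i j]
    exact Finset.sum_eq_zero fun j _ => h0 i j
  rw [← hsum]
  refine hν.integral_congr fun x hx => ?_
  have hx1 : ‖x‖ = 1 := by simpa using hx
  have hx0 : x ≠ 0 := by rintro rfl; simp at hx1
  have hxx : ∑ j, x j ^ 2 = 1 := by
    rw [← EuclideanSpace.real_norm_sq_eq, hx1, one_pow]
  have htx : ∑ i, X x i * x i = 0 := by
    have := ht x hx0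
    simpa [PiLp.inner_apply, mul_comm] using this
  have hrad : ∑ i, fderiv ℝ X x x i * x i = 0 := by
    have := inner_fderiv_self_of_tangent hx0 (hX x hx) ht
    simpa [PiLp.inner_apply, mul_comm] using this
  have hexp (i : Fin n) : fderiv ℝ X x x i =
      ∑ j, x j * fderiv ℝ X x (EuclideanSpace.single j 1) i := by
    have h := congrArg (fun y => fderiv ℝ X x y i) ((EuclideanSpace.basisFun (Fin n) ℝ).sum_repr x)
    simpa using h.symm
  have hterm (i j : Fin n) : fderiv ℝ (fun y => X y i * y j) x (rotGen i j x) =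
      fderiv ℝ X x (EuclideanSpace.single i 1) i * x j ^ 2
        + (if i = j then X x i * x j else 0)
        - x i * (x j * fderiv ℝ X x (EuclideanSpace.single j 1) i) - X x i * x i := by
    rw [(hder i j hx).fderiv, rotGen_apply]
    simp only [add_apply, smul_apply,
      ContinuousLinearMap.comp_apply, map_sub, map_smul, PiLp.proj_apply, smul_eq_mul]
    by_cases h : i = j
    · subst h; simp; ring
    · have h' : j ≠ i := fun h' => h h'.symm
      simp [h, h']; ring
  simp only [hterm, Finset.sum_sub_distrib, Finset.sum_add_distrib, Finset.sum_const,
    ← Finset.mul_sum, ← Finset.smul_sum, hxx, ← hexp]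
  simp only [Finset.sum_ite_eq, Finset.mem_univ, if_true, htx, mul_one, smul_zero, sub_zero,
    add_zero, ← divg_eq_sum]
  simp only [mul_comm (x _), hrad, sub_zero]

lemma ne_zero_of_mem_unit_sphere' {n : ℕ} {x : Euc n} (hx : x ∈ sphere (0 : Euc n) 1) : x ≠ 0 :=
  ne_zero_of_mem_sphere one_ne_zero ⟨x, hx⟩

lemma ContDiffAt.continuousAt_fderiv_of_one {E F : Type*} [NormedAddCommGroup E]
    [NormedSpace ℝ E] [NormedAddCommGroup F] [NormedSpace ℝ F] {f : E → F} {x : E}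
    (hf : ContDiffAt ℝ 1 f x) : ContinuousAt (fderiv ℝ f) x :=
  (hf.fderiv_right (m := 0) (by norm_num)).continuousAt

lemma divg_smul {n : ℕ} {φ : Euc n → ℝ} {X : Euc n → Euc n} {x : Euc n}
    (hφ : DifferentiableAt ℝ φ x) (hX : DifferentiableAt ℝ X x) :
    divg (fun y => φ y • X y) x = φ x * divg X x + fderiv ℝ φ x (X x) := by
  have h : ∀ v, fderiv ℝ (fun y => φ y • X y) x v = φ x • fderiv ℝ X x v + fderiv ℝ φ x v • X x := by
    intro v
    rw [fderiv_fun_smul hφ hX]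
    simp
  simp only [divg_eq_sum, h, PiLp.add_apply, PiLp.smul_apply, smul_eq_mul,
    Finset.sum_add_distrib, Finset.mul_sum]
  congr 1
  have := congrArg (fderiv ℝ φ x) ((EuclideanSpace.basisFun (Fin n) ℝ).sum_repr (X x))
  rw [← this]
  simp [mul_comm]

/-- Integration by parts on the sphere. -/
lemma IsSphereMeasure.integral_mul_divg {n : ℕ} {ν : Measure (Euc n)} (hν : IsSphereMeasure ν)
    {φ : Euc n → ℝ} {X : Euc n → Euc n}
    (hφ : ∀ x ∈ sphere (0 : Euc n) 1, ContDiffAt ℝ 1 φ x)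
    (hX : ∀ x ∈ sphere (0 : Euc n) 1, ContDiffAt ℝ 1 X x)
    (ht : ∀ y : Euc n, y ≠ 0 → ⟪X y, y⟫ = 0) :
    ∫ x, φ x * divg X x ∂ν = -∫ x, fderiv ℝ φ x (X x) ∂ν := by
  have h0 : ∫ x, divg (fun y => φ y • X y) x ∂ν = 0 := by
    refine hν.integral_divg
      (fun x hx => ((hφ x hx).smul (hX x hx)).differentiableAt one_ne_zero)
      (fun x hx =>
        ((hφ x hx).smul (hX x hx)).continuousAt_fderiv_of_one.continuousWithinAt) ?_
    intro y hy
    rw [inner_smul_left, ht y hy, mul_zero]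
  rw [eq_neg_iff_add_eq_zero, ← h0, ← integral_add]
  · exact hν.integral_congr fun x hx =>
      (divg_smul ((hφ x hx).differentiableAt one_ne_zero)
        ((hX x hx).differentiableAt one_ne_zero)).symm
  · exact hν.integrable (ContinuousOn.mul
      (fun x hx => (hφ x hx).continuousAt.continuousWithinAt) (continuousOn_divg fun x hx => (hX x hx).continuousAt_fderiv_of_one.continuousWithinAt))
  · exact hν.integrable (fun x hx => ((hφ x hx).continuousAt_fderiv_of_one.clm_apply
      (hX x hx).continuousAt).continuousWithinAt)

lemma inner_gradient {n : ℕ} (u : Euc n → ℝ) (x v : Euc n) : ⟪gradient u x, v⟫ = fderiv ℝ u x v := by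
  rw [gradient, InnerProductSpace.toDual_symm_apply]

namespace IsSphereFun

variable {n : ℕ} {u : Euc n → ℝ}

lemma contDiffAt (hu : IsSphereFun u) {x : Euc n} (hx : x ≠ 0) :
    ContDiffAt ℝ (⊤ : ℕ∞) u x :=
  hu.1.contDiffAt (isOpen_ne.mem_nhds hx)

lemma contDiffAt_gradient (hu : IsSphereFun u) {x : Euc n} (hx : x ≠ 0) :
    ContDiffAt ℝ (⊤ : ℕ∞) (gradient u) x :=
  (InnerProductSpace.toDual ℝ (Euc n)).symm.toContinuousLinearEquiv.contDiff.contDiffAt.comp x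
    ((hu.contDiffAt hx).fderiv_right (m := (⊤ : ℕ∞)) (by simp))

lemma contDiffAt_one (hu : IsSphereFun u) {x : Euc n} (hx : x ≠ 0) : ContDiffAt ℝ 1 u x :=
  (hu.contDiffAt hx).of_le (by exact_mod_cast le_top)

lemma contDiffAt_gradient_one (hu : IsSphereFun u) {x : Euc n} (hx : x ≠ 0) :
    ContDiffAt ℝ 1 (gradient u) x :=
  (hu.contDiffAt_gradient hx).of_le (by exact_mod_cast le_top)

lemma differentiableAt (hu : IsSphereFun u) {x : Euc n} (hx : x ≠ 0) : DifferentiableAt ℝ u x :=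
  (hu.contDiffAt_one hx).differentiableAt one_ne_zero

lemma differentiableAt_gradient (hu : IsSphereFun u) {x : Euc n} (hx : x ≠ 0) :
    DifferentiableAt ℝ (gradient u) x :=
  (hu.contDiffAt_gradient_one hx).differentiableAt one_ne_zero

lemma continuousOn (hu : IsSphereFun u) : ContinuousOn u (sphere 0 1) := fun _ hx =>
  (hu.differentiableAt (ne_zero_of_mem_unit_sphere' hx)).continuousAt.continuousWithinAt

lemma continuousOn_gradient (hu : IsSphereFun u) : ContinuousOn (gradient u) (sphere 0 1) :=
  fun _ hx =>
    (hu.differentiableAt_gradient (ne_zero_of_mem_unit_sphere' hx)).continuousAt.continuousWithinAt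

lemma continuousOn_fderiv_gradient (hu : IsSphereFun u) :
    ContinuousOn (fderiv ℝ (gradient u)) (sphere 0 1) := fun _ hx =>
  (hu.contDiffAt_gradient_one
    (ne_zero_of_mem_unit_sphere' hx)).continuousAt_fderiv_of_one.continuousWithinAt

lemma continuousOn_lapl (hu : IsSphereFun u) : ContinuousOn (lapl u) (sphere 0 1) :=
  continuousOn_divg hu.continuousOn_fderiv_gradient

lemma inner_gradient_self (hu : IsSphereFun u) {x : Euc n} (hx : x ≠ 0) :
    ⟪gradient u x, x⟫ = 0 := by
  rw [inner_gradient]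
  have h1 : HasDerivAt (fun t : ℝ => t • x) x 1 := by
    simpa using (hasDerivAt_id (1 : ℝ)).smul_const x
  have h2 : HasDerivAt (fun t : ℝ => u (t • x)) (fderiv ℝ u x x) 1 := by
    have h := (hu.differentiableAt hx).hasFDerivAt
    refine HasFDerivAt.comp_hasDerivAt (f := fun t : ℝ => t • x) (1 : ℝ) ?_ h1
    simpa using h
  have h3 : HasDerivAt (fun t : ℝ => u (t • x)) 0 1 := by
    refine (hasDerivAt_const (1 : ℝ) (u x)).congr_of_eventuallyEq ?_
    filter_upwards [lt_mem_nhds (zero_lt_one' ℝ)] with t ht using hu.2 x hx t ht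
  exact h2.unique h3

lemma hessBil_symm (hu : IsSphereFun u) {x : Euc n} (hx : x ≠ 0) (v w : Euc n) :
    hessBil u x v w = hessBil u x w v := by
  have hd : DifferentiableAt ℝ (fderiv ℝ u) x :=
    ((hu.contDiffAt hx).fderiv_right (m := 1)
      (by simpa [one_add_one_eq_two] using WithTop.coe_le_coe.2 (le_top : (2 : ℕ∞) ≤ ⊤))).differentiableAt
      one_ne_zero
  have key (a b : Euc n) : hessBil u x a b = fderiv ℝ (fderiv ℝ u) x a b := by
    have : gradient u = (InnerProductSpace.toDual ℝ (Euc n)).symm ∘ fderiv ℝ u := rfl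
    rw [hessBil, this, LinearIsometryEquiv.comp_fderiv]
    exact InnerProductSpace.toDual_symm_apply
  rw [key, key]
  exact ((hu.contDiffAt hx).isSymmSndFDerivAt (by
    simpa using WithTop.coe_le_coe.2 (le_top : (2 : ℕ∞) ≤ ⊤))).eq v w

end IsSphereFun

lemma hasFDerivAt_inner_pow {n : ℕ} (a x : Euc n) (k : ℕ) :
    HasFDerivAt (fun y => ⟪a, y⟫ ^ k) ((k * ⟪a, x⟫ ^ (k - 1)) • innerSL ℝ a) x := by
  simpa [nsmul_eq_mul, smul_smul] using ((innerSL ℝ a).hasFDerivAt (x := x)).pow k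

lemma contDiff_inner_pow {n : ℕ} (a : Euc n) (k : ℕ) :
    ContDiff ℝ 1 (fun y => ⟪a, y⟫ ^ k) :=
  (contDiff_const.inner ℝ contDiff_id).pow k

/-- The tangent field `x ↦ |x|² a - ⟨a, x⟩ x`, the spherical gradient of `⟨a, ·⟩`. -/
def tangentField {n : ℕ} (a x : Euc n) : Euc n := ‖x‖ ^ 2 • a - ⟪a, x⟫ • x

lemma contDiff_tangentField {n : ℕ} (a : Euc n) : ContDiff ℝ 1 (tangentField a) :=
  ((contDiff_norm_sq ℝ).smul contDiff_const).sub
    ((contDiff_const.inner ℝ contDiff_id).smul contDiff_id)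

lemma inner_tangentField_self {n : ℕ} (a x : Euc n) : ⟪tangentField a x, x⟫ = 0 := by
  rw [tangentField, inner_sub_left, real_inner_smul_left, real_inner_smul_left,
    real_inner_self_eq_norm_sq]
  ring

lemma divg_tangentField {n : ℕ} (a x : Euc n) :
    divg (tangentField a) x = -((n : ℝ) - 1) * ⟪a, x⟫ := by
  have h1 : HasFDerivAt (tangentField a)
      (((2 : ℕ) • innerSL ℝ x).smulRight a -
        (⟪a, x⟫ • ContinuousLinearMap.id ℝ (Euc n) + (innerSL ℝ a).smulRight x)) x := by
    refine HasFDerivAt.sub ?_ ?_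
    · simpa using (hasStrictFDerivAt_norm_sq x).hasFDerivAt.smul_const a
    · exact ((innerSL ℝ a).hasFDerivAt (x := x)).smul (hasFDerivAt_id x)
  have hx : ⟪a, x⟫ = ∑ i, a i * x i := by simp [PiLp.inner_apply, mul_comm]
  rw [divg_eq_sum, h1.fderiv]
  simp only [sub_apply, add_apply, smul_apply, ContinuousLinearMap.smulRight_apply,
    ContinuousLinearMap.id_apply, innerSL_apply_apply, EuclideanSpace.inner_single_right,
    PiLp.sub_apply, PiLp.add_apply, PiLp.smul_apply, smul_eq_mul, Finset.sum_sub_distrib,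
    Finset.sum_add_distrib, ← Finset.mul_sum, PiLp.single_apply]
  simp only [one_mul, conj_trivial, if_true, mul_one, Finset.sum_const, Finset.card_univ,
    Fintype.card_fin, nsmul_eq_mul, Nat.cast_ofNat, mul_assoc, ← Finset.mul_sum, ← hx]
  have hx' : ∑ i, x i * a i = ⟪a, x⟫ := by rw [hx]; simp only [mul_comm]
  rw [hx']
  ring

/-- Recursion for the moments of an eigenfunction against powers of linear forms. -/
lemma IsSphereMeasure.moment_recursion {n : ℕ} {ν : Measure (Euc n)} (hν : IsSphereMeasure ν)
    {φ : Euc n → ℝ} {μ : ℝ} (hφ : IsSphereEigenfun φ μ) (a : Euc n) (k : ℕ) :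
    ((k : ℝ) * (k + n - 2) - μ) * ∫ x, φ x * ⟪a, x⟫ ^ k ∂ν =
      k * (k - 1) * ‖a‖ ^ 2 * ∫ x, φ x * ⟪a, x⟫ ^ (k - 2) ∂ν := by
  have hs := hφ.1
  have hne {x : Euc n} (hx : x ∈ sphere (0 : Euc n) 1) : x ≠ 0 := ne_zero_of_mem_unit_sphere' hx
  let c : Euc n → ℝ := fun x => k * ⟪a, x⟫ ^ (k - 1)
  have hc : ContDiff ℝ 1 c := contDiff_const.mul (contDiff_inner_pow a (k - 1))
  have hd (x : Euc n) : fderiv ℝ c x (tangentField a x) =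
      k * ((k - 1 : ℕ) * ⟪a, x⟫ ^ (k - 2)) * (‖x‖ ^ 2 * ‖a‖ ^ 2 - ⟪a, x⟫ ^ 2) := by
    rw [((hasFDerivAt_inner_pow a x (k - 1)).const_mul (k : ℝ)).fderiv]
    simp only [smul_apply, innerSL_apply_apply, smul_eq_mul, tangentField, inner_sub_right,
      real_inner_smul_right, real_inner_self_eq_norm_sq, Nat.sub_sub]
    ring
  have hdivg (x : Euc n) (hx : x ∈ sphere (0 : Euc n) 1) :
      divg (fun y => c y • tangentField a y) x =
        k * (k - 1) * ‖a‖ ^ 2 * ⟪a, x⟫ ^ (k - 2) - k * (k + n - 2) * ⟪a, x⟫ ^ k := by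
    have hx1 : ‖x‖ = 1 := by simpa using hx
    rw [divg_smul (hc.differentiable one_ne_zero x)
      ((contDiff_tangentField a).differentiable one_ne_zero x), divg_tangentField, hd, hx1,
      show c x = k * ⟪a, x⟫ ^ (k - 1) from rfl]
    clear hd hc
    clear c
    match k with
    | 0 => simp
    | 1 => simp; ring
    | k + 2 => simp; ring
  have h1 : ∫ x, ⟪a, x⟫ ^ k * divg (gradient φ) x ∂ν =
      -∫ x, fderiv ℝ (fun y => ⟪a, y⟫ ^ k) x (gradient φ x) ∂ν :=
    hν.integral_mul_divg (fun x _ => (contDiff_inner_pow a k).contDiffAt)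
      (fun x hx => hs.contDiffAt_gradient_one (hne hx)) fun y hy => hs.inner_gradient_self hy
  have h2 : ∫ x, φ x * divg (fun y => c y • tangentField a y) x ∂ν =
      -∫ x, fderiv ℝ φ x (c x • tangentField a x) ∂ν :=
    hν.integral_mul_divg (fun x hx => hs.contDiffAt_one (hne hx))
      (fun x _ => (hc.smul (contDiff_tangentField a)).contDiffAt)
      fun y _ => by rw [real_inner_smul_left, inner_tangentField_self, mul_zero]
  have h3 : ∫ x, fderiv ℝ (fun y => ⟪a, y⟫ ^ k) x (gradient φ x) ∂ν =
      ∫ x, fderiv ℝ φ x (c x • tangentField a x) ∂ν := by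
    refine hν.integral_congr fun x hx => ?_
    have hx1 : ‖x‖ = 1 := by simpa using hx
    rw [(hasFDerivAt_inner_pow a x k).fderiv, ← inner_gradient, tangentField,
      real_inner_smul_right, inner_sub_right, real_inner_smul_right, real_inner_smul_right,
      hs.inner_gradient_self (hne hx), hx1,
      real_inner_comm a (gradient φ x)]
    simp [c]
  have hcont (j : ℕ) : ContinuousOn (fun x => φ x * ⟪a, x⟫ ^ j) (sphere 0 1) :=
    hs.continuousOn.mul (contDiff_inner_pow a j).continuous.continuousOn
  have h4 : ∫ x, ⟪a, x⟫ ^ k * divg (gradient φ) x ∂ν = -μ * ∫ x, φ x * ⟪a, x⟫ ^ k ∂ν := by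
    rw [← integral_const_mul]
    refine hν.integral_congr fun x hx => ?_
    have := hφ.2 x hx
    rw [lapl] at this
    rw [this]
    ring
  have h5 : ∫ x, φ x * divg (fun y => c y • tangentField a y) x ∂ν =
      k * (k - 1) * ‖a‖ ^ 2 * (∫ x, φ x * ⟪a, x⟫ ^ (k - 2) ∂ν) -
        k * (k + n - 2) * ∫ x, φ x * ⟪a, x⟫ ^ k ∂ν := by
    rw [← integral_const_mul, ← integral_const_mul, ← integral_sub
      ((hν.integrable (hcont _)).const_mul _) ((hν.integrable (hcont _)).const_mul _)]
    refine hν.integral_congr fun x hx => ?_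
    rw [hdivg x hx]
    ring
  linarith

lemma IsSphereMeasure.moment_eq_zero {n : ℕ} {ν : Measure (Euc n)} (hν : IsSphereMeasure ν)
    {φ : Euc n → ℝ} {μ : ℝ} (hφ : IsSphereEigenfun φ μ)
    (h : ∀ k : ℕ, (k : ℝ) * (k + n - 2) = μ → ∀ a, ∫ x, φ x * ⟪a, x⟫ ^ k ∂ν = 0)
    (a : Euc n) (k : ℕ) : ∫ x, φ x * ⟪a, x⟫ ^ k ∂ν = 0 := by
  induction k using Nat.strong_induction_on with
  | _ k ih =>
    by_cases hk : (k : ℝ) * (k + n - 2) = μ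
    · exact h k hk a
    · have hrec := hν.moment_recursion hφ a k
      refine (mul_eq_zero.1 (hrec.trans ?_)).resolve_left (sub_ne_zero.2 hk)
      match k with
      | 0 => simp
      | 1 => simp
      | k + 2 => simp [ih k (by omega)]

/-- A nonzero sphere measure charges every ball centred on the sphere. -/
lemma IsSphereMeasure.measure_ball_ne_zero {n : ℕ} {ν : Measure (Euc n)}
    (hν : IsSphereMeasure ν) (h0 : ν ≠ 0) {x : Euc n} (hx : x ∈ sphere (0 : Euc n) 1) {r : ℝ}
    (hr : 0 < r) : ν (ball x r) ≠ 0 := by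
  intro hb
  apply h0
  rw [← Measure.measure_univ_eq_zero, ← measure_congr (Filter.eventuallyEq_univ.2 hν.ae_mem)]
  refine measure_null_of_locally_null _ fun y hy =>
    ⟨ball y r, mem_nhdsWithin_of_mem_nhds (ball_mem_nhds y hr), ?_⟩
  let e : Euc n ≃ₗᵢ[ℝ] Euc n := (Submodule.span ℝ {x - y})ᗮ.reflection
  have he : e x = y := Submodule.reflection_sub (by
    rw [mem_sphere_zero_iff_norm.1 hx, mem_sphere_zero_iff_norm.1 hy])
  rw [← (hν.invariant e).measure_preimage isOpen_ball.measurableSet.nullMeasurableSet, ← he,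
    e.preimage_ball, e.symm_apply_apply]
  exact hb

lemma IsSphereMeasure.eq_zero_of_integral_sq_eq_zero {n : ℕ} {ν : Measure (Euc n)}
    (hν : IsSphereMeasure ν) (h0 : ν ≠ 0) {φ : Euc n → ℝ} (hφ : ContinuousOn φ (sphere 0 1))
    (h : ∫ x, φ x ^ 2 ∂ν = 0) {x : Euc n} (hx : x ∈ sphere (0 : Euc n) 1) : φ x = 0 := by
  by_contra hne
  have hae := (integral_eq_zero_iff_of_nonneg (fun x => sq_nonneg (φ x))
    (hν.integrable (hφ.pow 2))).1 h
  obtain ⟨r, hr, hball⟩ := Metric.mem_nhdsWithin_iff.1 ((hφ x hx).eventually_ne hne)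
  refine hν.measure_ball_ne_zero h0 hx hr (measure_mono_null (fun y hy => ?_)
    (ae_iff.1 (hae.and hν.ae_mem)))
  rintro ⟨h1, h2⟩
  exact hball ⟨hy, h2⟩ (pow_eq_zero_iff two_ne_zero |>.1 h1)

/-- The exponentials `x ↦ exp ⟨a, x⟩` on the sphere, as a monoid morphism in `a`. -/
def expHom (n : ℕ) : Multiplicative (Euc n) →* C(sphere (0 : Euc n) 1, ℝ) where
  toFun a := ⟨fun x => exp ⟪a.toAdd, (x : Euc n)⟫, by fun_prop⟩
  map_one' := by ext; simp
  map_mul' a b := by ext; simp [inner_add_left, exp_add]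

lemma expHom_separatesPoints (n : ℕ) :
    (Algebra.adjoin ℝ (range (expHom n))).SeparatesPoints := by
  intro x y hxy
  refine ⟨_, ⟨expHom n (Multiplicative.ofAdd ((x : Euc n) - y)),
    Algebra.subset_adjoin (mem_range_self _), rfl⟩, fun h => hxy ?_⟩
  have h1 : ⟪(x : Euc n) - y, (x : Euc n)⟫ = ⟪(x : Euc n) - y, (y : Euc n)⟫ := exp_injective h
  have h2 : ⟪(x : Euc n) - y, (x : Euc n) - y⟫ = 0 := by rw [inner_sub_right, h1, sub_self]
  exact Subtype.ext (sub_eq_zero.1 (inner_self_eq_zero.1 h2))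

lemma IsSphereMeasure.integral_mul_exp_eq_zero {n : ℕ} {ν : Measure (Euc n)}
    (hν : IsSphereMeasure ν) {φ : Euc n → ℝ} (hφ : ContinuousOn φ (sphere 0 1))
    (h : ∀ (a : Euc n) (k : ℕ), ∫ x, φ x * ⟪a, x⟫ ^ k ∂ν = 0) (a : Euc n) :
    ∫ x, φ x * exp ⟪a, x⟫ ∂ν = 0 := by
  have hfin := hν.finite
  obtain ⟨C, hC⟩ := (isCompact_sphere (0 : Euc n) 1).exists_bound_of_continuousOn hφ
  have hcont (k : ℕ) : ContinuousOn (fun x => φ x * (⟪a, x⟫ ^ k / k.factorial)) (sphere 0 1) :=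
    hφ.mul ((contDiff_inner_pow a k).continuous.div_const _).continuousOn
  have hsum : HasSum (fun k : ℕ => ∫ x, φ x * (⟪a, x⟫ ^ k / k.factorial) ∂ν)
      (∫ x, φ x * exp ⟪a, x⟫ ∂ν) := by
    refine hasSum_integral_of_dominated_convergence
      (fun k _ => C * (‖a‖ ^ k / k.factorial))
      (fun k => (hν.integrable (hcont k)).aestronglyMeasurable) (fun k => ?_) ?_ ?_ ?_
    · refine hν.ae_mem.mono fun x hx => ?_
      have hx1 : ‖x‖ = 1 := by simpa using hx
      have hi : |⟪a, x⟫| ≤ ‖a‖ := by simpa [hx1] using abs_real_inner_le_norm a x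
      rw [norm_mul, norm_div, norm_pow, Real.norm_natCast]
      have hφx := hC x hx
      rw [Real.norm_eq_abs ⟪a, x⟫]
      gcongr
      exact (norm_nonneg _).trans hφx
    · exact Filter.Eventually.of_forall fun x =>
        (Real.summable_pow_div_factorial ‖a‖).mul_left C
    · exact integrable_const _
    · refine Filter.Eventually.of_forall fun x => HasSum.mul_left _ ?_
      rw [Real.exp_eq_exp_ℝ]
      exact NormedSpace.expSeries_div_hasSum_exp _
  have hz (k : ℕ) : ∫ x, φ x * (⟪a, x⟫ ^ k / k.factorial) ∂ν = 0 := by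
    simp_rw [← mul_div_assoc, integral_div, h, zero_div]
  simp only [hz] at hsum
  exact hsum.unique hasSum_zero

/-- A continuous function on the sphere whose moments all vanish is zero. -/
lemma IsSphereMeasure.eq_zero_of_moments {n : ℕ} {ν : Measure (Euc n)} (hν : IsSphereMeasure ν)
    (h0 : ν ≠ 0) {φ : Euc n → ℝ} (hφ : ContinuousOn φ (sphere 0 1))
    (h : ∀ (a : Euc n) (k : ℕ), ∫ x, φ x * ⟪a, x⟫ ^ k ∂ν = 0)
    {x : Euc n} (hx : x ∈ sphere (0 : Euc n) 1) : φ x = 0 := by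
  have hfin := hν.finite
  have hres : ν.restrict (sphere 0 1) = ν := Measure.restrict_eq_self_of_ae_mem hν.ae_mem
  let σ : Measure (sphere (0 : Euc n) 1) := ν.comap (↑)
  have hσ (F : Euc n → ℝ) : ∫ x, F x ∂ν = ∫ x : sphere (0 : Euc n) 1, F x ∂σ := by
    rw [integral_subtype_comap isClosed_sphere.measurableSet, hres]
  have hσfin : IsFiniteMeasure σ := by
    refine ⟨?_⟩
    rw [comap_subtype_coe_apply isClosed_sphere.measurableSet]
    exact measure_lt_top _ _
  let Φ : C(sphere (0 : Euc n) 1, ℝ) := ⟨fun x => φ x, hφ.domRestrict⟩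
  have hint (F : C(sphere (0 : Euc n) 1, ℝ)) : Integrable F σ :=
    F.continuous.integrable_of_hasCompactSupport (HasCompactSupport.of_compactSpace _)
  have hspan (p : C(sphere (0 : Euc n) 1, ℝ)) (hp : p ∈ Algebra.adjoin ℝ (range (expHom n))) :
      ∫ x, Φ x * p x ∂σ = 0 := by
    rw [← Subalgebra.mem_toSubmodule, Algebra.adjoin_eq_span] at hp
    have hcl : (Submonoid.closure (range (expHom n)) : Set C(sphere (0 : Euc n) 1, ℝ)) =
        range (expHom n) := by
      rw [← MonoidHom.coe_mrange, Submonoid.closure_eq]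
    rw [hcl] at hp
    induction hp using Submodule.span_induction with
    | mem p hp =>
      obtain ⟨a, rfl⟩ := hp
      exact (hσ fun x => φ x * exp ⟪a.toAdd, x⟫).symm.trans
        (hν.integral_mul_exp_eq_zero hφ h a.toAdd)
    | zero => simp
    | add p q _ _ hp hq =>
      simp only [ContinuousMap.add_apply, mul_add]
      refine (integral_add (hint (Φ * p)) (hint (Φ * q))).trans ?_
      exact (congrArg₂ (· + ·) hp hq).trans (add_zero 0)
    | smul c p _ hp =>
      simp only [ContinuousMap.smul_apply, smul_eq_mul, mul_left_comm _ c]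
      rw [integral_const_mul, hp, mul_zero]
  have hdense := ContinuousMap.subalgebra_topologicalClosure_eq_top_of_separatesPoints _
    (expHom_separatesPoints n)
  have hΦ : Φ ∈ closure (Algebra.adjoin ℝ (range (expHom n)) : Set C(sphere (0 : Euc n) 1, ℝ)) := by
    rw [← Subalgebra.topologicalClosure_coe, hdense]; trivial
  have hsq : ∫ x, Φ x ^ 2 ∂σ = 0 := by
    refine le_antisymm (le_of_forall_pos_le_add fun ε hε => ?_)
      (integral_nonneg fun x => sq_nonneg _)
    let I := ∫ x, |Φ x| ∂σ
    have hI : 0 ≤ I := integral_nonneg fun x => abs_nonneg _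
    obtain ⟨p, hp, hpd⟩ := Metric.mem_closure_iff.1 hΦ (ε / (I + 1)) (by positivity)
    have hpt (x : sphere (0 : Euc n) 1) : Φ x ^ 2 - Φ x * p x ≤ |Φ x| * (ε / (I + 1)) := by
      have h1 : |Φ x - p x| ≤ ε / (I + 1) := by
        rw [← Real.dist_eq]; exact (ContinuousMap.dist_apply_le_dist x).trans hpd.le
      calc Φ x ^ 2 - Φ x * p x = Φ x * (Φ x - p x) := by ring
        _ ≤ |Φ x| * |Φ x - p x| := by rw [← abs_mul]; exact le_abs_self _
        _ ≤ _ := by gcongr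
    have h2 := MeasureTheory.integral_mono ((hint (Φ ^ 2)).sub (hint (Φ * p)))
      ((hint |Φ|).mul_const (ε / (I + 1))) hpt
    rw [integral_sub' (hint (Φ ^ 2)) (hint (Φ * p)), integral_mul_const] at h2
    have h3 : ∫ x, (Φ * p) x ∂σ = 0 := hspan p hp
    rw [h3, sub_zero] at h2
    rw [zero_add]
    refine h2.trans ?_
    change I * (ε / (I + 1)) ≤ ε
    rw [mul_div_assoc', div_le_iff₀ (by positivity)]
    nlinarith
  exact hν.eq_zero_of_integral_sq_eq_zero h0 hφ ((hσ fun x => φ x ^ 2).trans hsq) hx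

section Congruence

variable {n : ℕ} {φ ψ : Euc n → ℝ}

lemma fderiv_gradient_congr_of_ne_zero (h : ∀ x, x ≠ 0 → φ x = ψ x) {x : Euc n} (hx : x ≠ 0) :
    fderiv ℝ (gradient φ) x = fderiv ℝ (gradient ψ) x := by
  have hev {y : Euc n} (hy : y ≠ 0) : φ =ᶠ[nhds y] ψ :=
    (isOpen_ne.eventually_mem hy).mono fun z hz => h z hz
  refine Filter.EventuallyEq.fderiv_eq ((isOpen_ne.eventually_mem hx).mono fun y hy => ?_)
  rw [gradient, gradient, (hev hy).fderiv_eq]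

lemma IsSphereFun.congr (hφ : IsSphereFun φ) (h : ∀ x, x ≠ 0 → ψ x = φ x) : IsSphereFun ψ := by
  refine ⟨hφ.1.congr h, fun x hx t ht => ?_⟩
  rw [h x hx, h _ (smul_ne_zero ht.ne' hx), hφ.2 x hx t ht]

lemma IsSphereEigenfun.congr {μ : ℝ} (hφ : IsSphereEigenfun φ μ) (h : ∀ x, x ≠ 0 → ψ x = φ x) :
    IsSphereEigenfun ψ μ := by
  refine ⟨hφ.1.congr h, fun x hx => ?_⟩
  have hx0 := ne_zero_of_mem_unit_sphere' hx
  rw [h x hx0, ← hφ.2 x hx, lapl, lapl, divg, divg, fderiv_gradient_congr_of_ne_zero h hx0]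

end Congruence

/-- The space of smooth functions on the sphere. -/
def sphereFuns (n : ℕ) : Submodule ℝ (Euc n → ℝ) where
  carrier := {φ | IsSphereFun φ}
  zero_mem' := ⟨contDiffOn_const, fun _ _ _ _ => rfl⟩
  add_mem' {φ ψ} hφ hψ := ⟨hφ.1.add hψ.1, fun x hx t ht => by
    simp only [Pi.add_apply, hφ.2 x hx t ht, hψ.2 x hx t ht]⟩
  smul_mem' c φ hφ := ⟨hφ.1.const_smul c, fun x hx t ht => by
    simp only [Pi.smul_apply, hφ.2 x hx t ht]⟩

lemma gradient_add_of_isSphereFun {n : ℕ} {φ ψ : Euc n → ℝ} (hφ : IsSphereFun φ)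
    (hψ : IsSphereFun ψ) {x : Euc n} (hx : x ≠ 0) :
    gradient (φ + ψ) x = gradient φ x + gradient ψ x := by
  simp only [gradient]
  rw [fderiv_add (hφ.differentiableAt hx) (hψ.differentiableAt hx), map_add]

lemma gradient_smul_of_isSphereFun {n : ℕ} (c : ℝ) {φ : Euc n → ℝ} (hφ : IsSphereFun φ)
    {x : Euc n} (hx : x ≠ 0) : gradient (c • φ) x = c • gradient φ x := by
  simp only [gradient]
  rw [fderiv_const_smul (hφ.differentiableAt hx), map_smul]

/-- The Hessian at a point, as a linear map on the smooth functions on the sphere. -/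
def hessAt {n : ℕ} {x : Euc n} (hx : x ≠ 0) : sphereFuns n →ₗ[ℝ] Euc n →L[ℝ] Euc n where
  toFun φ := fderiv ℝ (gradient (φ : Euc n → ℝ)) x
  map_add' φ ψ := by
    have h : gradient ((φ : Euc n → ℝ) + (ψ : Euc n → ℝ)) =ᶠ[nhds x]
        gradient (φ : Euc n → ℝ) + gradient (ψ : Euc n → ℝ) :=
      (isOpen_ne.eventually_mem hx).mono fun y hy => gradient_add_of_isSphereFun φ.2 ψ.2 hy
    rw [Submodule.coe_add, h.fderiv_eq, fderiv_add (IsSphereFun.differentiableAt_gradient φ.2 hx)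
      (IsSphereFun.differentiableAt_gradient ψ.2 hx)]
  map_smul' c φ := by
    have h : gradient (c • (φ : Euc n → ℝ)) =ᶠ[nhds x] c • gradient (φ : Euc n → ℝ) :=
      (isOpen_ne.eventually_mem hx).mono fun y hy => gradient_smul_of_isSphereFun c φ.2 hy
    rw [Submodule.coe_smul, h.fderiv_eq,
      fderiv_const_smul (IsSphereFun.differentiableAt_gradient φ.2 hx), RingHom.id_apply]

lemma lapl_eq_trace_hessAt {n : ℕ} {x : Euc n} (hx : x ≠ 0) (φ : sphereFuns n) :
    lapl φ x = LinearMap.trace ℝ (Euc n) (hessAt hx φ).toLinearMap := rfl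

/-- The eigenfunctions of `-Δ` with eigenvalue `μ`, normalised to vanish at the origin. -/
def eigenspaceAt (n : ℕ) (μ : ℝ) : Submodule ℝ (Euc n → ℝ) where
  carrier := {φ | IsSphereEigenfun φ μ ∧ φ 0 = 0}
  zero_mem' := by
    refine ⟨⟨(sphereFuns n).zero_mem, fun x hx => ?_⟩, rfl⟩
    have := lapl_eq_trace_hessAt (ne_zero_of_mem_unit_sphere' hx) 0
    simpa using this
  add_mem' {φ ψ} hφ hψ := by
    refine ⟨⟨(sphereFuns n).add_mem hφ.1.1 hψ.1.1, fun x hx => ?_⟩, by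
      simp [hφ.2, hψ.2]⟩
    have hx0 := ne_zero_of_mem_unit_sphere' hx
    have h := lapl_eq_trace_hessAt hx0 (⟨φ, hφ.1.1⟩ + ⟨ψ, hψ.1.1⟩)
    rw [map_add, ContinuousLinearMap.toLinearMap_add, map_add, ← lapl_eq_trace_hessAt,
      ← lapl_eq_trace_hessAt] at h
    refine h.trans ?_
    simp only [hφ.1.2 x hx, hψ.1.2 x hx, Pi.add_apply]
    ring
  smul_mem' c φ hφ := by
    refine ⟨⟨(sphereFuns n).smul_mem c hφ.1.1, fun x hx => ?_⟩, by simp [hφ.2]⟩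
    have hx0 := ne_zero_of_mem_unit_sphere' hx
    have h := lapl_eq_trace_hessAt hx0 (c • ⟨φ, hφ.1.1⟩)
    rw [map_smul, ContinuousLinearMap.toLinearMap_smul, map_smul, ← lapl_eq_trace_hessAt] at h
    refine h.trans ?_
    simp only [hφ.1.2 x hx, Pi.smul_apply, smul_eq_mul]
    ring

lemma eq_zero_of_eq_zero_on_sphere {n : ℕ} {φ : Euc n → ℝ} (hφ : IsSphereFun φ)
    (h : ∀ x ∈ sphere (0 : Euc n) 1, φ x = 0) {x : Euc n} (hx : x ≠ 0) : φ x = 0 := by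
  rw [← hφ.2 x hx ‖x‖⁻¹ (by positivity)]
  exact h _ (by simp [norm_smul, hx])

lemma sphere_eigenvalue_injective {n : ℕ} (hn : 2 ≤ n) {j k : ℕ}
    (h : (j : ℝ) * (j + n - 2) = k * (k + n - 2)) : j = k := by
  have hn' : (2 : ℝ) ≤ n := by exact_mod_cast hn
  have h' : ((j : ℝ) - k) * (j + k + (n - 2)) = 0 := by linear_combination h
  rcases mul_eq_zero.1 h' with h' | h'
  · exact_mod_cast sub_eq_zero.1 h'
  · have hj : (0 : ℝ) ≤ j := j.cast_nonneg
    have hk : (0 : ℝ) ≤ k := k.cast_nonneg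
    have e : (j : ℝ) = k := by linarith
    exact_mod_cast e

/-- The moments of degree `k`, as a linear map on an eigenspace. -/
def momentMap {n : ℕ} {ν : Measure (Euc n)} (hν : IsSphereMeasure ν) (μ : ℝ) (k : ℕ) :
    eigenspaceAt n μ →ₗ[ℝ] (Fin k → Fin n) → ℝ where
  toFun φ s := ∫ x, (φ : Euc n → ℝ) x * ∏ i, x (s i) ∂ν
  map_add' φ ψ := by
    ext s
    have hc : ContinuousOn (fun x : Euc n => ∏ i, x (s i)) (sphere 0 1) := by fun_prop
    simp only [Submodule.coe_add, Pi.add_apply, add_mul]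
    exact integral_add (hν.integrable (φ.2.1.1.continuousOn.mul hc))
      (hν.integrable (ψ.2.1.1.continuousOn.mul hc))
  map_smul' c φ := by
    ext s
    simp [mul_assoc, integral_const_mul]

lemma finiteDimensional_eigenspaceAt {n : ℕ} (hn : 2 ≤ n) {ν : Measure (Euc n)}
    (hν : IsSphereMeasure ν) (h0 : ν ≠ 0) (k : ℕ) :
    FiniteDimensional ℝ (eigenspaceAt n ((k : ℝ) * (k + n - 2))) := by
  refine FiniteDimensional.of_injective (momentMap hν _ k)
    ((injective_iff_map_eq_zero _).2 fun φ hφ => ?_)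
  have hc := φ.2.1.1.continuousOn
  have hm (a : Euc n) : ∫ x, (φ : Euc n → ℝ) x * ⟪a, x⟫ ^ k ∂ν = 0 := by
    have hexp (x : Euc n) : (φ : Euc n → ℝ) x * ⟪a, x⟫ ^ k =
        ∑ s : Fin k → Fin n, (∏ i, a (s i)) * ((φ : Euc n → ℝ) x * ∏ i, x (s i)) := by
      have : ⟪a, x⟫ = ∑ i, a i * x i := by simp [PiLp.inner_apply, mul_comm]
      rw [this, Fintype.sum_pow, Finset.mul_sum]
      simp only [Finset.prod_mul_distrib]
      exact Finset.sum_congr rfl fun s _ => by ring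
    simp only [hexp]
    have hp (s : Fin k → Fin n) : ContinuousOn (fun x : Euc n =>
        (∏ i, a (s i)) * ((φ : Euc n → ℝ) x * ∏ i, x (s i))) (sphere 0 1) := by
      fun_prop
    rw [integral_finsetSum _ fun s _ => hν.integrable (hp s)]
    refine Finset.sum_eq_zero fun s _ => ?_
    rw [integral_const_mul]
    exact mul_eq_zero_of_right _ (congrFun hφ s)
  have hz := hν.moment_eq_zero φ.2.1 fun j hj a => by
    rw [sphere_eigenvalue_injective hn hj]; exact hm a
  ext x
  by_cases hx : x = 0
  · rw [hx, φ.2.2]; rfl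
  · exact eq_zero_of_eq_zero_on_sphere φ.2.1.1
      (fun y hy => hν.eq_zero_of_moments h0 hc hz hy) hx

/-- On a finite-dimensional space of smooth functions on the sphere, the Hessian is controlled
by the `L²` norm. -/
lemma IsSphereMeasure.exists_hess_bound {n : ℕ} {ν : Measure (Euc n)} (hν : IsSphereMeasure ν)
    (h0 : ν ≠ 0) {V : Submodule ℝ (Euc n → ℝ)} [FiniteDimensional ℝ V]
    (hV : V ≤ sphereFuns n) (hV0 : ∀ φ ∈ V, φ 0 = 0) :
    ∃ C : ℝ, 0 ≤ C ∧ ∀ φ ∈ V, ∀ x ∈ sphere (0 : Euc n) 1,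
      ‖fderiv ℝ (gradient φ) x‖ ≤ C * √(∫ y, φ y ^ 2 ∂ν) := by
  have hfin := hν.finite
  have hc (φ : V) : ContinuousOn (φ : Euc n → ℝ) (sphere 0 1) :=
    IsSphereFun.continuousOn (hV φ.2)
  have hLp (φ : V) : MemLp (φ : Euc n → ℝ) 2 ν :=
    (memLp_two_iff_integrable_sq (hν.integrable (hc φ)).aestronglyMeasurable).2
      (hν.integrable ((hc φ).pow 2))
  let T : V →ₗ[ℝ] Lp ℝ 2 ν :=
    { toFun := fun φ => (hLp φ).toLp _
      map_add' := fun φ ψ => (hLp φ).toLp_add (hLp ψ)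
      map_smul' := fun c φ => (hLp φ).toLp_const_smul c }
  have hT (φ : V) : ‖T φ‖ = √(∫ y, (φ : Euc n → ℝ) y ^ 2 ∂ν) := by
    rw [← Real.sqrt_sq (norm_nonneg (T φ)), ← real_inner_self_eq_norm_sq, L2.inner_def]
    congr 1
    refine integral_congr_ae ?_
    filter_upwards [(hLp φ).coeFn_toLp] with x hx
    simp only [T, LinearMap.coe_mk, AddHom.coe_mk, hx]
    simp [pow_two]
  let b := Module.finBasis ℝ V
  let L := T ∘ₗ b.equivFun.symm.toLinearMap
  have hL : LinearMap.ker L = ⊥ := by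
    refine LinearMap.ker_eq_bot'.2 fun c hc0 => ?_
    set φ : V := b.equivFun.symm c with hφ
    have hTφ : T φ = 0 := hc0
    have hz : φ = 0 := by
      have h1 : ∫ y, (φ : Euc n → ℝ) y ^ 2 ∂ν = 0 := by
        have := hT φ
        rw [hTφ, norm_zero, eq_comm,
          Real.sqrt_eq_zero (integral_nonneg fun y => sq_nonneg _)] at this
        exact this
      ext x
      by_cases hx : x = 0
      · rw [hx, hV0 φ φ.2]; rfl
      · exact eq_zero_of_eq_zero_on_sphere (hV φ.2)
          (fun y hy => hν.eq_zero_of_integral_sq_eq_zero h0 (hc φ) h1 hy) hx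
    exact b.equivFun.symm.map_eq_zero_iff.1 (hφ ▸ hz)
  obtain ⟨K, -, hK⟩ := L.exists_antilipschitzWith hL
  have hB (i : Fin (Module.finrank ℝ V)) : ∃ B : ℝ, ∀ x ∈ sphere (0 : Euc n) 1,
      ‖fderiv ℝ (gradient (b i : Euc n → ℝ)) x‖ ≤ B :=
    (isCompact_sphere 0 1).exists_bound_of_continuousOn
      (IsSphereFun.continuousOn_fderiv_gradient (hV (b i).2))
  choose B hB using hB
  refine ⟨K * ∑ i, |B i|, by positivity, fun φ hφ x hx => ?_⟩
  have hx0 := ne_zero_of_mem_unit_sphere' hx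
  let c := b.equivFun ⟨φ, hφ⟩
  have hcK : ‖c‖ ≤ K * √(∫ y, φ y ^ 2 ∂ν) := by
    have h1 : ‖c‖ ≤ K * ‖L c‖ := by simpa using hK.le_mul_dist c 0
    rwa [show L c = T ⟨φ, hφ⟩ by simp [L, c], hT] at h1
  have hsum : fderiv ℝ (gradient φ) x =
      ∑ i, c i • fderiv ℝ (gradient (b i : Euc n → ℝ)) x := by
    have h1 := congrArg (fun v => hessAt hx0 (Submodule.inclusion hV v)) (b.sum_equivFun ⟨φ, hφ⟩)
    simp only [map_sum, map_smul] at h1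
    exact h1.symm
  rw [hsum]
  calc _ ≤ ∑ i, ‖c‖ * |B i| := by
        refine norm_sum_le_of_le _ fun i _ => ?_
        rw [norm_smul]
        gcongr
        · exact norm_le_pi_norm c i
        · exact (hB i x hx).trans (le_abs_self _)
    _ = ‖c‖ * ∑ i, |B i| := by rw [Finset.mul_sum]
    _ ≤ K * √(∫ y, φ y ^ 2 ∂ν) * ∑ i, |B i| := by gcongr
    _ = _ := by ring

/-- The Hessian of a low-frequency function is controlled by its `L²` norm. -/
lemma IsSphereMeasure.exists_hess_bound_of_isLowFrequency {n : ℕ} (hn : 2 ≤ n)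
    {ν : Measure (Euc n)} (hν : IsSphereMeasure ν) (h0 : ν ≠ 0) (lam : ℝ) :
    ∃ C : ℝ, 0 ≤ C ∧ ∀ u : Euc n → ℝ, IsLowFrequency lam u → ∀ x ∈ sphere (0 : Euc n) 1,
      ‖fderiv ℝ (gradient u) x‖ ≤ C * √(∫ y, u y ^ 2 ∂ν) := by
  obtain ⟨K, hK⟩ := exists_nat_ge lam
  let E (k : Fin (K + 1)) := eigenspaceAt n (((k : ℕ) : ℝ) * ((k : ℕ) + n - 2))
  have hE (k : Fin (K + 1)) : FiniteDimensional ℝ (E k) :=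
    finiteDimensional_eigenspaceAt hn hν h0 k
  let V := ⨆ k, E k
  have hVfin : FiniteDimensional ℝ V := Submodule.finiteDimensional_iSup E
  have hV : V ≤ sphereFuns n := iSup_le fun k φ hφ => hφ.1.1
  have hV0 : V ≤ LinearMap.ker (LinearMap.proj (R := ℝ) (φ := fun _ : Euc n => ℝ) 0) :=
    iSup_le fun k φ hφ => hφ.2
  obtain ⟨C, hC, hb⟩ := hν.exists_hess_bound h0 hV fun φ hφ => hV0 hφ
  refine ⟨C, hC, fun u hu x hx => ?_⟩
  obtain ⟨N, φ, μ, c, hφ, hsum⟩ := hu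
  have hmem (i : Fin N) : ({0}ᶜ : Set (Euc n)).indicator (φ i) ∈ V := by
    have hcongr (y : Euc n) (hy : y ≠ 0) : ({0}ᶜ : Set (Euc n)).indicator (φ i) y = φ i y :=
      indicator_of_mem hy _
    by_cases hk : ∃ k : ℕ, (k : ℝ) * (k + n - 2) = μ i
    · obtain ⟨k, hk⟩ := hk
      have hkK : k ≤ K := by
        have hn' : (2 : ℝ) ≤ n := by exact_mod_cast hn
        have h1 : (k : ℝ) * (k + n - 2) ≤ K := hk.trans_le ((hφ i).2.trans hK)
        have h2 : (k : ℝ) ≤ k * k := by exact_mod_cast Nat.le_mul_self k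
        have h3 : (0 : ℝ) ≤ k := k.cast_nonneg
        have h4 : (k : ℝ) ≤ K := by nlinarith
        exact_mod_cast h4
      refine Submodule.mem_iSup_of_mem (⟨k, Nat.lt_succ_of_le hkK⟩ : Fin (K + 1)) ?_
      refine ⟨?_, by simp⟩
      simpa only [hk] using (hφ i).1.congr hcongr
    · have hz (y : Euc n) (hy : y ≠ 0) : φ i y = 0 :=
        eq_zero_of_eq_zero_on_sphere (hφ i).1.1 (fun z hz =>
          hν.eq_zero_of_moments h0 (hφ i).1.1.continuousOn
            (hν.moment_eq_zero (hφ i).1 fun k hk' => absurd ⟨k, hk'⟩ hk) hz) hy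
      have : ({0}ᶜ : Set (Euc n)).indicator (φ i) = 0 := by
        ext y
        by_cases hy : y = 0
        · simp [hy]
        · rw [hcongr y hy, hz y hy]; rfl
      rw [this]
      exact V.zero_mem
  let v : Euc n → ℝ := ∑ i, c i • ({0}ᶜ : Set (Euc n)).indicator (φ i)
  have hv : v ∈ V := V.sum_mem fun i _ => V.smul_mem _ (hmem i)
  have huv (y : Euc n) (hy : y ≠ 0) : u y = v y := by
    rw [hsum y hy]
    simp [v, Finset.sum_apply, hy]
  rw [fderiv_gradient_congr_of_ne_zero huv (ne_zero_of_mem_unit_sphere' hx),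
    hν.integral_congr fun y hy => show u y ^ 2 = v y ^ 2 by
      rw [huv y (ne_zero_of_mem_unit_sphere' hy)]]
  exact hb v hv x hx

/-- A `C¹` function of two variables near the origin agrees there with a compactly supported
one. -/
lemma exists_contDiff_hasCompactSupport_eq {k : ℝ × ℝ → ℝ} {O : Set (ℝ × ℝ)} (hO : IsOpen O)
    (h0 : (0 : ℝ × ℝ) ∈ O) (hk : ContDiffOn ℝ 1 k O) :
    ∃ (r : ℝ) (k' : ℝ × ℝ → ℝ), 0 < r ∧ ContDiff ℝ 1 k' ∧ HasCompactSupport k' ∧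
      ∀ p ∈ ball (0 : ℝ × ℝ) r, k' p = k p := by
  obtain ⟨ρ, hρ, hρO⟩ := Metric.isOpen_iff.1 hO 0 h0
  let φ : ContDiffBump (0 : ℝ × ℝ) := ⟨ρ / 4, ρ / 2, by positivity, by linarith⟩
  refine ⟨ρ / 4, fun p => φ p * k p, by positivity, ?_, φ.hasCompactSupport.mul_right, ?_⟩
  · refine contDiff_iff_contDiffAt.2 fun p => ?_
    by_cases hp : p ∈ tsupport (fun p => φ p * k p)
    swap
    · exact contDiffAt_const.congr_of_eventuallyEq (notMem_tsupport_iff_eventuallyEq.1 hp)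
    have hp' : p ∈ closedBall (0 : ℝ × ℝ) (ρ / 2) :=
      φ.tsupport_eq ▸ (tsupport_mul_subset_left hp)
    exact φ.contDiff.contDiffAt.mul
      (hk.contDiffAt (hO.mem_nhds (hρO (closedBall_subset_ball (by linarith) hp'))))
  · intro p hp
    have : φ p = 1 := φ.one_of_mem_closedBall (ball_subset_closedBall hp)
    simp only [this, one_mul]

/-- The mean of `k` over the segment from `(s, 0)` to `(s, q)`. -/
def segMean (k : ℝ × ℝ → ℝ) (p : ℝ × ℝ) : ℝ := ∫ θ in (0 : ℝ)..1, k (p.1, p.2 * θ)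

/-- The derivative of the integrand in `segMean`. -/
def segDeriv (k : ℝ × ℝ → ℝ) (p : ℝ × ℝ) (θ : ℝ) : ℝ × ℝ →L[ℝ] ℝ :=
  (fderiv ℝ k (p.1, p.2 * θ)).comp
    ((ContinuousLinearMap.fst ℝ ℝ ℝ).prod (θ • ContinuousLinearMap.snd ℝ ℝ ℝ))

lemma continuous_segDeriv {k : ℝ × ℝ → ℝ} (hk : ContDiff ℝ 1 k) :
    Continuous (fun z : (ℝ × ℝ) × ℝ => segDeriv k z.1 z.2) := by
  have h := hk.continuous_fderiv one_ne_zero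
  refine Continuous.clm_comp (h.comp (by fun_prop)) ?_
  exact (ContinuousLinearMap.prodₗᵢ ℝ (E := ℝ × ℝ) (F := ℝ) (G := ℝ)).continuous.comp
    (continuous_const.prodMk (continuous_snd.smul continuous_const))

lemma segMean_hasFDerivAt {k : ℝ × ℝ → ℝ} (hk : ContDiff ℝ 1 k) (p : ℝ × ℝ) :
    HasFDerivAt (segMean k) (∫ θ in (0 : ℝ)..1, segDeriv k p θ) p := by
  have hkc := hk.continuous
  have hc := continuous_segDeriv hk
  obtain ⟨C, hC⟩ := ((isCompact_closedBall p 1).prod (isCompact_Icc (a := (0 : ℝ))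
    (b := 1))).exists_bound_of_continuousOn hc.continuousOn
  have hF (x : ℝ × ℝ) : Continuous (fun θ : ℝ => k (x.1, x.2 * θ)) := by fun_prop
  refine intervalIntegral.hasFDerivAt_integral_of_dominated_of_fderiv_le
    (bound := fun _ => C) (closedBall_mem_nhds p one_pos)
    (Filter.Eventually.of_forall fun x => (hF x).aestronglyMeasurable)
    ((hF p).intervalIntegrable _ _)
    (hc.comp (Continuous.prodMk_right p)).aestronglyMeasurable
    (Filter.Eventually.of_forall fun θ hθ x hx => hC (x, θ) ⟨hx, ?_⟩)
    intervalIntegrable_const (Filter.Eventually.of_forall fun θ _ x _ => ?_)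
  · rw [uIoc_of_le zero_le_one] at hθ
    exact Ioc_subset_Icc_self hθ
  · have h1 := (hk.differentiable one_ne_zero (x.1, x.2 * θ)).hasFDerivAt
    have h2 : HasFDerivAt (fun x : ℝ × ℝ => (x.1, x.2 * θ))
        ((ContinuousLinearMap.fst ℝ ℝ ℝ).prod (θ • ContinuousLinearMap.snd ℝ ℝ ℝ)) x :=
      hasFDerivAt_fst.prodMk (hasFDerivAt_snd.mul_const θ)
    exact h1.comp x h2

lemma contDiff_segMean {k : ℝ × ℝ → ℝ} (hk : ContDiff ℝ 1 k) : ContDiff ℝ 1 (segMean k) := by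
  rw [contDiff_one_iff_hasFDerivAt]
  exact ⟨fun p => ∫ θ in (0 : ℝ)..1, segDeriv k p θ,
    intervalIntegral.continuous_parametric_intervalIntegral_of_continuous'
      (continuous_segDeriv hk) _ _, segMean_hasFDerivAt hk⟩

lemma mul_segMean_eq (k : ℝ × ℝ → ℝ) (s q : ℝ) :
    q * segMean k (s, q) = ∫ σ in (0 : ℝ)..q, k (s, σ) := by
  have := intervalIntegral.smul_integral_comp_mul_left (a := 0) (b := 1)
    (fun σ => k (s, σ)) q
  simpa [segMean] using this

lemma exists_fderiv_primitive {k : ℝ × ℝ → ℝ} (hk : ContDiff ℝ 1 k)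
    (hs : HasCompactSupport k) :
    ∃ (C : ℝ) (K' : ℝ × ℝ → ℝ), 0 ≤ C ∧ ∀ p : ℝ × ℝ, |K' p| ≤ C * |p.2| ∧
      HasFDerivAt (fun p : ℝ × ℝ => p.2 * segMean k p)
        (K' p • ContinuousLinearMap.fst ℝ ℝ ℝ + k p • ContinuousLinearMap.snd ℝ ℝ ℝ) p := by
  obtain ⟨C, hC⟩ := (hk.continuous_fderiv one_ne_zero).bounded_above_of_compact_support (hs.fderiv (𝕜 := ℝ))
  have hC0 : 0 ≤ C := (norm_nonneg _).trans (hC 0)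
  refine ⟨C, fun p => p.2 * (∫ θ in (0 : ℝ)..1, segDeriv k p θ) (1, 0), hC0, fun p => ⟨?_, ?_⟩⟩
  · have hint : IntervalIntegrable (segDeriv k p) volume 0 1 :=
      ((continuous_segDeriv hk).comp (Continuous.prodMk_right p)).intervalIntegrable _ _
    simp only [ContinuousLinearMap.intervalIntegral_apply hint]
    rw [abs_mul, mul_comm]
    gcongr
    have h : ∀ θ ∈ uIoc (0 : ℝ) 1, ‖segDeriv k p θ (1, 0)‖ ≤ C := by
      intro θ _
      have h1 : segDeriv k p θ (1, 0) = fderiv ℝ k (p.1, p.2 * θ) (1, 0) := by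
        simp [segDeriv]
      rw [h1]
      refine (ContinuousLinearMap.le_opNorm _ _).trans ?_
      simpa using hC _
    simpa using intervalIntegral.norm_integral_le_of_norm_le_const h
  · have hM := (contDiff_segMean hk).differentiable one_ne_zero p
    have hd : HasFDerivAt (fun p : ℝ × ℝ => p.2 * segMean k p)
        (p.2 • (∫ θ in (0 : ℝ)..1, segDeriv k p θ) +
          segMean k p • ContinuousLinearMap.snd ℝ ℝ ℝ) p :=
      hasFDerivAt_snd.mul (segMean_hasFDerivAt hk p)
    have hq : HasDerivAt (fun q => q * segMean k (p.1, q)) (k p) p.2 := by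
      simp only [mul_segMean_eq]
      have hc : Continuous (fun σ => k (p.1, σ)) := hk.continuous.comp (by fun_prop)
      exact intervalIntegral.integral_hasDerivAt_right (hc.intervalIntegrable _ _)
        (hc.stronglyMeasurableAtFilter _ _) hc.continuousAt
    have hq' : HasDerivAt (fun q => q * segMean k (p.1, q))
        ((p.2 • (∫ θ in (0 : ℝ)..1, segDeriv k p θ) +
          segMean k p • ContinuousLinearMap.snd ℝ ℝ ℝ) (0, 1)) p.2 := by
      have h1 : HasDerivAt (fun q : ℝ => (p.1, q)) ((0 : ℝ), (1 : ℝ)) p.2 :=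
        (hasDerivAt_const p.2 p.1).prodMk (hasDerivAt_id p.2)
      exact HasFDerivAt.comp_hasDerivAt (f := fun q : ℝ => (p.1, q)) p.2 hd h1
    have he := hq.unique hq'
    convert hd using 1
    refine ContinuousLinearMap.ext fun v => ?_
    have hv : v = v.1 • ((1 : ℝ), (0 : ℝ)) + v.2 • ((0 : ℝ), (1 : ℝ)) := by ext <;> simp
    conv_rhs => rw [hv, map_add, map_smul, map_smul, ← he]
    simp [mul_comm]

/-- A primitive in the second variable of a `C¹` function with value `1` at the origin. -/
lemma exists_primitive {k : ℝ × ℝ → ℝ} {O : Set (ℝ × ℝ)} (hO : IsOpen O)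
    (h0 : (0 : ℝ × ℝ) ∈ O) (hk : ContDiffOn ℝ 1 k O) (hk0 : k 0 = 1) :
    ∃ (C : ℝ) (K K' : ℝ × ℝ → ℝ), 0 ≤ C ∧ ContDiff ℝ 1 K ∧ ∀ η : ℝ, 0 < η →
      ∃ r : ℝ, 0 < r ∧ ∀ p ∈ ball (0 : ℝ × ℝ) r,
        HasFDerivAt K
          (K' p • ContinuousLinearMap.fst ℝ ℝ ℝ + k p • ContinuousLinearMap.snd ℝ ℝ ℝ) p ∧
        |K' p| ≤ C * |p.2| ∧ |k p - 1| ≤ η ∧ |K p - p.2| ≤ η * |p.2| := by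
  obtain ⟨r, k', hr, hk', hsupp, hkk'⟩ := exists_contDiff_hasCompactSupport_eq hO h0 hk
  obtain ⟨C, K', hC, hK'⟩ := exists_fderiv_primitive hk' hsupp
  refine ⟨C, fun p => p.2 * segMean k' p, K', hC, contDiff_snd.mul (contDiff_segMean hk'),
    fun η hη => ?_⟩
  have hk'0 : k' 0 = 1 := by rw [hkk' 0 (mem_ball_self hr), hk0]
  obtain ⟨ρ, hρ, hρη⟩ := Metric.continuousAt_iff.1 (hk'.continuous.continuousAt (x := 0)) η hη
  rw [hk'0] at hρη
  refine ⟨min r ρ, lt_min hr hρ, fun p hp => ?_⟩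
  have hpr : p ∈ ball (0 : ℝ × ℝ) r := ball_subset_ball (min_le_left _ _) hp
  have hpρ : p ∈ ball (0 : ℝ × ℝ) ρ := ball_subset_ball (min_le_right _ _) hp
  refine ⟨hkk' p hpr ▸ (hK' p).2, (hK' p).1, ?_, ?_⟩
  · rw [← hkk' p hpr, ← Real.dist_eq]; exact (hρη hpρ).le
  · have h1 : p.2 * segMean k' p - p.2 = p.2 * ∫ θ in (0 : ℝ)..1, (k' (p.1, p.2 * θ) - 1) := by
      have hc : Continuous (fun θ : ℝ => k' (p.1, p.2 * θ)) := hk'.continuous.comp (by fun_prop)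
      rw [intervalIntegral.integral_sub (hc.intervalIntegrable _ _) intervalIntegrable_const]
      simp [segMean, mul_sub]
    rw [h1, abs_mul, mul_comm]
    gcongr
    have h2 : ∀ θ ∈ uIoc (0 : ℝ) 1, ‖k' (p.1, p.2 * θ) - 1‖ ≤ η := by
      intro θ hθ
      rw [uIoc_of_le zero_le_one] at hθ
      rw [← dist_eq_norm]
      refine (hρη ?_).le
      rw [mem_ball_zero_iff, Prod.norm_def, max_lt_iff] at hpρ
      rw [dist_zero_right, Prod.norm_def, max_lt_iff]
      refine ⟨hpρ.1, lt_of_le_of_lt ?_ hpρ.2⟩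
      rw [norm_mul, Real.norm_of_nonneg hθ.1.le]
      exact mul_le_of_le_one_right (norm_nonneg _) hθ.2
    simpa using intervalIntegral.norm_integral_le_of_norm_le_const h2

namespace IsSphereFun

variable {n : ℕ} {u v : Euc n → ℝ}

lemma contDiffAt_inner_gradient (hu : IsSphereFun u) (hv : IsSphereFun v) {x : Euc n}
    (hx : x ≠ 0) : ContDiffAt ℝ 1 (fun y => ⟪gradient u y, gradient v y⟫) x :=
  (hu.contDiffAt_gradient_one hx).inner ℝ (hv.contDiffAt_gradient_one hx)

lemma fderiv_inner_gradient (hu : IsSphereFun u) (hv : IsSphereFun v) {x : Euc n} (hx : x ≠ 0)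
    (w : Euc n) : fderiv ℝ (fun y => ⟪gradient u y, gradient v y⟫) x w =
      hessBil u x w (gradient v x) + hessBil v x w (gradient u x) := by
  rw [fderiv_inner_apply ℝ (hu.differentiableAt_gradient hx) (hv.differentiableAt_gradient hx),
    hessBil, hessBil, real_inner_comm (gradient u x), add_comm]

lemma contDiffAt_comp (hu : IsSphereFun u) {x : Euc n} (hx : x ≠ 0) {Φ : ℝ × ℝ → ℝ}
    (hΦ : ContDiffAt ℝ 1 Φ (u x, ‖gradient u x‖ ^ 2)) :
    ContDiffAt ℝ 1 (fun y => Φ (u y, ‖gradient u y‖ ^ 2)) x :=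
  hΦ.comp x ((hu.contDiffAt_one hx).prodMk ((hu.contDiffAt_gradient_one hx).norm_sq ℝ))

lemma fderiv_comp (hu : IsSphereFun u) {x : Euc n} (hx : x ≠ 0) {Φ : ℝ × ℝ → ℝ} {a b : ℝ}
    (hΦ : HasFDerivAt Φ (a • ContinuousLinearMap.fst ℝ ℝ ℝ + b • ContinuousLinearMap.snd ℝ ℝ ℝ)
      (u x, ‖gradient u x‖ ^ 2)) (w : Euc n) :
    fderiv ℝ (fun y => Φ (u y, ‖gradient u y‖ ^ 2)) x w =
      a * ⟪gradient u x, w⟫ + 2 * b * hessBil u x w (gradient u x) := by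
  have h1 := (hu.differentiableAt hx).hasFDerivAt
  have h2 := (hu.differentiableAt_gradient hx).hasFDerivAt.norm_sq
  have h3 := HasFDerivAt.comp (f := fun y => (u y, ‖gradient u y‖ ^ 2)) x hΦ (h1.prodMk h2)
  have h4 : (fun y => Φ (u y, ‖gradient u y‖ ^ 2)) = Φ ∘ fun y => (u y, ‖gradient u y‖ ^ 2) := rfl
  rw [h4, h3.fderiv, inner_gradient, hessBil, real_inner_comm]
  simp [innerSL_apply_apply]
  ring

end IsSphereFun

lemma abs_hessBil_le {n : ℕ} {u : Euc n → ℝ} {B : ℝ} {x : Euc n} (hB : ‖fderiv ℝ (gradient u) x‖ ≤ B) (a b : Euc n) :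
    |hessBil u x a b| ≤ B * (‖a‖ * ‖b‖) := by
  rw [hessBil, ← mul_assoc]
  refine (abs_real_inner_le_norm _ _).trans ?_
  gcongr
  exact (ContinuousLinearMap.le_opNorm _ _).trans (by gcongr)

lemma abs_lapl_le {n : ℕ} {u : Euc n → ℝ} {B : ℝ} {x : Euc n} (hB : ‖fderiv ℝ (gradient u) x‖ ≤ B) :
    |lapl u x| ≤ n * B := by
  rw [lapl, divg_eq_sum]
  refine (Finset.abs_sum_le_sum_abs _ _).trans ?_
  have h (i : Fin n) : |fderiv ℝ (gradient u) x (EuclideanSpace.single i 1) i| ≤ B := by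
    rw [← Real.norm_eq_abs]
    refine (PiLp.norm_apply_le _ i).trans ((ContinuousLinearMap.le_opNorm _ _).trans ?_)
    simpa using hB
  simpa using Finset.sum_le_sum fun i (_ : i ∈ Finset.univ) => h i

section Orthogonality

variable {n : ℕ} {ν : Measure (Euc n)} {lam : ℝ} {u u₁ u₂ : Euc n → ℝ}

lemma IsSphereMeasure.integral_mul_eq_zero_of_isLowFrequency (hν : IsSphereMeasure ν)
    (h₁ : IsLowFrequency lam u₁) (hu₂ : IsSphereFun u₂)
    (h₂ : ∀ φ μ, IsSphereEigenfun φ μ → μ ≤ lam → ∫ x, u₂ x * φ x ∂ν = 0) :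
    ∫ x, u₂ x * u₁ x ∂ν = 0 ∧ ∫ x, u₂ x * lapl u₁ x ∂ν = 0 := by
  obtain ⟨N, φ, μ, c, hφ, hsum⟩ := h₁
  have hzero (d : Fin N → ℝ) : ∫ x, u₂ x * ∑ i, d i * φ i x ∂ν = 0 := by
    have hi (i : Fin N) : Integrable (fun x => d i * (u₂ x * φ i x)) ν :=
      (hν.integrable (hu₂.continuousOn.mul (hφ i).1.1.continuousOn)).const_mul _
    simp only [Finset.mul_sum, mul_left_comm (u₂ _) (d _)]
    rw [integral_finsetSum _ fun i _ => hi i]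
    refine Finset.sum_eq_zero fun i _ => ?_
    rw [integral_const_mul, h₂ _ _ (hφ i).1 (hφ i).2, mul_zero]
  refine ⟨?_, ?_⟩
  · rw [← hzero c]
    exact hν.integral_congr fun x hx => by rw [hsum x (ne_zero_of_mem_unit_sphere' hx)]
  · rw [← hzero fun i => -(c i * μ i)]
    refine hν.integral_congr fun x hx => ?_
    have hx0 := ne_zero_of_mem_unit_sphere' hx
    let ψ (i : Fin N) : sphereFuns n := ⟨φ i, (hφ i).1.1⟩
    have h1 : lapl u₁ x = lapl ((∑ i, c i • ψ i : sphereFuns n) : Euc n → ℝ) x := by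
      rw [lapl, lapl, divg, divg, fderiv_gradient_congr_of_ne_zero (fun y hy => ?_) hx0]
      simp [hsum y hy, ψ, Finset.sum_apply]
    have h2 (i : Fin N) : LinearMap.trace ℝ (Euc n) (hessAt hx0 (ψ i)).toLinearMap =
        -μ i * φ i x := (hφ i).1.2 x hx
    rw [h1, lapl_eq_trace_hessAt hx0]
    simp only [map_sum, map_smul, ContinuousLinearMap.toLinearMap_sum,
      ContinuousLinearMap.toLinearMap_smul, h2, smul_eq_mul]
    congr 1
    exact Finset.sum_congr rfl fun i _ => by ring

lemma gradient_eq_add (hu₁ : IsSphereFun u₁) (hu₂ : IsSphereFun u₂)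
    (h : ∀ x : Euc n, x ≠ 0 → u x = u₁ x + u₂ x) {x : Euc n} (hx : x ≠ 0) :
    gradient u x = gradient u₁ x + gradient u₂ x := by
  rw [← gradient_add_of_isSphereFun hu₁ hu₂ hx, gradient, gradient]
  congr 1
  exact Filter.EventuallyEq.fderiv_eq ((isOpen_ne.eventually_mem hx).mono fun y hy => h y hy)

lemma IsSphereMeasure.integral_low_le (hν : IsSphereMeasure ν) (hu₁ : IsSphereFun u₁)
    (hu₂ : IsSphereFun u₂) (h : ∀ x : Euc n, x ≠ 0 → u x = u₁ x + u₂ x)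
    (h₁ : IsLowFrequency lam u₁)
    (h₂ : ∀ φ μ, IsSphereEigenfun φ μ → μ ≤ lam → ∫ x, u₂ x * φ x ∂ν = 0) :
    ∫ x, u₁ x ^ 2 ∂ν ≤ ∫ x, u x ^ 2 ∂ν ∧
      ∫ x, ‖gradient u₁ x‖ ^ 2 ∂ν ≤ ∫ x, ‖gradient u x‖ ^ 2 ∂ν := by
  obtain ⟨ho, hlapl⟩ := hν.integral_mul_eq_zero_of_isLowFrequency h₁ hu₂ h₂
  have hne {x : Euc n} (hx : x ∈ sphere (0 : Euc n) 1) : x ≠ 0 := ne_zero_of_mem_unit_sphere' hx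
  have c₁ := hu₁.continuousOn
  have c₂ := hu₂.continuousOn
  have d₁ := hu₁.continuousOn_gradient
  have d₂ := hu₂.continuousOn_gradient
  refine ⟨?_, ?_⟩
  · have h3 : ∫ x, u x ^ 2 ∂ν = ∫ x, u₁ x ^ 2 ∂ν + ∫ x, (2 * (u₂ x * u₁ x) + u₂ x ^ 2) ∂ν := by
      rw [← integral_add (hν.integrable (by fun_prop)) (hν.integrable (by fun_prop))]
      exact hν.integral_congr fun x hx => by rw [h x (hne hx)]; ring
    rw [h3, integral_add (hν.integrable (by fun_prop)) (hν.integrable (by fun_prop)),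
      integral_const_mul, ho, mul_zero, zero_add]
    exact le_add_of_nonneg_right (integral_nonneg fun x => sq_nonneg _)
  · have hi : ∫ x, ⟪gradient u₂ x, gradient u₁ x⟫ ∂ν = 0 := by
      have := hν.integral_mul_divg (fun x hx => hu₂.contDiffAt_one (hne hx))
        (fun x hx => hu₁.contDiffAt_gradient_one (hne hx)) fun y hy => hu₁.inner_gradient_self hy
      simp only [inner_gradient]
      rw [← neg_eq_zero, ← this]
      exact hlapl
    have h3 : ∫ x, ‖gradient u x‖ ^ 2 ∂ν = ∫ x, ‖gradient u₁ x‖ ^ 2 ∂ν +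
        ∫ x, (2 * ⟪gradient u₂ x, gradient u₁ x⟫ + ‖gradient u₂ x‖ ^ 2) ∂ν := by
      rw [← integral_add (hν.integrable (by fun_prop)) (hν.integrable (by fun_prop))]
      exact hν.integral_congr fun x hx => by
        rw [gradient_eq_add hu₁ hu₂ h (hne hx), norm_add_sq_real, real_inner_comm]; ring
    rw [h3, integral_add (hν.integrable (by fun_prop)) (hν.integrable (by fun_prop)),
      integral_const_mul, hi, mul_zero, zero_add]
    exact le_add_of_nonneg_right (integral_nonneg fun x => sq_nonneg _)

end Orthogonality

/-- The vector field `g(u, |∇u|²) ∇u`. -/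
def weightedGradient {n : ℕ} (g : ℝ × ℝ → ℝ) (u : Euc n → ℝ) (y : Euc n) : Euc n :=
  g (u y, ‖gradient u y‖ ^ 2) • gradient u y

section WeightedGradient

variable {n : ℕ} {ν : Measure (Euc n)} {u u₁ : Euc n → ℝ} {g : ℝ × ℝ → ℝ}

lemma inner_weightedGradient_self (hu : IsSphereFun u) {y : Euc n} (hy : y ≠ 0) :
    ⟪weightedGradient g u y, y⟫ = 0 := by
  rw [weightedGradient, real_inner_smul_left, hu.inner_gradient_self hy, mul_zero]

lemma contDiffAt_weightedGradient (hu : IsSphereFun u)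
    (hg : ∀ x ∈ sphere (0 : Euc n) 1, ContDiffAt ℝ 1 g (u x, ‖gradient u x‖ ^ 2))
    {x : Euc n} (hx : x ∈ sphere (0 : Euc n) 1) : ContDiffAt ℝ 1 (weightedGradient g u) x :=
  (hu.contDiffAt_comp (ne_zero_of_mem_unit_sphere' hx) (hg x hx)).smul
    (hu.contDiffAt_gradient_one (ne_zero_of_mem_unit_sphere' hx))

lemma continuousOn_divg_weightedGradient (hu : IsSphereFun u)
    (hg : ∀ x ∈ sphere (0 : Euc n) 1, ContDiffAt ℝ 1 g (u x, ‖gradient u x‖ ^ 2)) :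
    ContinuousOn (divg (weightedGradient g u)) (sphere 0 1) :=
  continuousOn_divg fun _ hx =>
    (contDiffAt_weightedGradient hu hg hx).continuousAt_fderiv_of_one.continuousWithinAt

lemma IsSphereMeasure.integral_mul_divg_weightedGradient (hν : IsSphereMeasure ν)
    (hu : IsSphereFun u)
    (hg : ∀ x ∈ sphere (0 : Euc n) 1, ContDiffAt ℝ 1 g (u x, ‖gradient u x‖ ^ 2))
    {φ : Euc n → ℝ} (hφ : ∀ x ∈ sphere (0 : Euc n) 1, ContDiffAt ℝ 1 φ x) :
    ∫ x, φ x * divg (weightedGradient g u) x ∂ν =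
      -∫ x, fderiv ℝ φ x (weightedGradient g u x) ∂ν :=
  hν.integral_mul_divg hφ (fun _ hx => contDiffAt_weightedGradient hu hg hx)
    fun _ hy => inner_weightedGradient_self hu hy

lemma continuousOn_fderiv_weightedGradient (hu : IsSphereFun u)
    (hg : ∀ x ∈ sphere (0 : Euc n) 1, ContDiffAt ℝ 1 g (u x, ‖gradient u x‖ ^ 2))
    {φ : Euc n → ℝ} (hφ : ∀ x ∈ sphere (0 : Euc n) 1, ContDiffAt ℝ 1 φ x) :
    ContinuousOn (fun x => fderiv ℝ φ x (weightedGradient g u x)) (sphere 0 1) := fun x hx =>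
  ((hφ x hx).continuousAt_fderiv_of_one.clm_apply
    (contDiffAt_weightedGradient hu hg hx).continuousAt).continuousWithinAt

/-- The cubic term, after integrating by parts against a primitive `H` of `f / g`. -/
lemma IsSphereMeasure.integral_cubic_ge (hν : IsSphereMeasure ν) (hu : IsSphereFun u)
    (hg : ∀ x ∈ sphere (0 : Euc n) 1, ContDiffAt ℝ 1 g (u x, ‖gradient u x‖ ^ 2))
    {f H H' : ℝ × ℝ → ℝ} {C ε η : ℝ} (hC : 0 ≤ C) (hH : ContDiff ℝ 1 H)
    (hf : ∀ x ∈ sphere (0 : Euc n) 1, ContinuousAt f (u x, ‖gradient u x‖ ^ 2))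
    (hH' : ∀ x ∈ sphere (0 : Euc n) 1, HasFDerivAt H
      (H' (u x, ‖gradient u x‖ ^ 2) • ContinuousLinearMap.fst ℝ ℝ ℝ +
        (f (u x, ‖gradient u x‖ ^ 2) / g (u x, ‖gradient u x‖ ^ 2)) •
          ContinuousLinearMap.snd ℝ ℝ ℝ) (u x, ‖gradient u x‖ ^ 2))
    (hH'b : ∀ x ∈ sphere (0 : Euc n) 1,
      |H' (u x, ‖gradient u x‖ ^ 2)| ≤ C * ‖gradient u x‖ ^ 2)
    (hHb : ∀ x ∈ sphere (0 : Euc n) 1,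
      |H (u x, ‖gradient u x‖ ^ 2) - ‖gradient u x‖ ^ 2| ≤ η * ‖gradient u x‖ ^ 2)
    (hg0 : ∀ x ∈ sphere (0 : Euc n) 1, 0 < g (u x, ‖gradient u x‖ ^ 2))
    (hg2 : ∀ x ∈ sphere (0 : Euc n) 1, g (u x, ‖gradient u x‖ ^ 2) ≤ 2)
    (hq : ∀ x ∈ sphere (0 : Euc n) 1, ‖gradient u x‖ ^ 2 ≤ ε) :
    -(1 / 2) * (∫ x, divg (weightedGradient g u) x * ‖gradient u x‖ ^ 2 ∂ν)
      - η / 2 * (∫ x, |divg (weightedGradient g u) x| * ‖gradient u x‖ ^ 2 ∂ν)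
      - C * ε * (∫ x, ‖gradient u x‖ ^ 2 ∂ν) ≤
    ∫ x, f (u x, ‖gradient u x‖ ^ 2) * hessBil u x (gradient u x) (gradient u x) ∂ν := by
  have hne {x : Euc n} (hx : x ∈ sphere (0 : Euc n) 1) : x ≠ 0 := ne_zero_of_mem_unit_sphere' hx
  set G := divg (weightedGradient g u) with hGdef
  have hG : ContinuousOn G (sphere 0 1) := continuousOn_divg_weightedGradient hu hg
  have hd := hu.continuousOn_gradient
  have hφ : ∀ x ∈ sphere (0 : Euc n) 1,
      ContDiffAt ℝ 1 (fun y => H (u y, ‖gradient u y‖ ^ 2)) x :=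
    fun x hx => hu.contDiffAt_comp (hne hx) hH.contDiffAt
  have hφc : ContinuousOn (fun y => H (u y, ‖gradient u y‖ ^ 2)) (sphere 0 1) :=
    fun x hx => (hφ x hx).continuousAt.continuousWithinAt
  have hA : ContinuousOn (fun x => f (u x, ‖gradient u x‖ ^ 2) *
      hessBil u x (gradient u x) (gradient u x)) (sphere 0 1) := by
    have h1 : ContinuousOn (fun x => f (u x, ‖gradient u x‖ ^ 2)) (sphere 0 1) := fun x hx =>
      ContinuousWithinAt.comp (t := univ) (f := fun x => (u x, ‖gradient u x‖ ^ 2))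
        (hf x hx).continuousWithinAt
        ((hu.continuousOn x hx).prodMk ((hd x hx).norm.pow 2)) (mapsTo_univ _ _)
    exact h1.mul ((hu.continuousOn_fderiv_gradient.clm_apply hd).inner hd)
  have hF := continuousOn_fderiv_weightedGradient hu hg hφ
  have hq0 (x : Euc n) : 0 ≤ ‖gradient u x‖ ^ 2 := sq_nonneg _
  have hlow : ∫ x, (1 / 2 * fderiv ℝ (fun y => H (u y, ‖gradient u y‖ ^ 2)) x
      (weightedGradient g u x) - C * ε * ‖gradient u x‖ ^ 2) ∂ν ≤
      ∫ x, f (u x, ‖gradient u x‖ ^ 2) * hessBil u x (gradient u x) (gradient u x) ∂ν := by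
    refine hν.integral_mono (by fun_prop) hA fun x hx => ?_
    rw [hu.fderiv_comp (hne hx) (hH' x hx), weightedGradient, real_inner_smul_right,
      real_inner_self_eq_norm_sq]
    have h1 : hessBil u x (g (u x, ‖gradient u x‖ ^ 2) • gradient u x) (gradient u x) =
        g (u x, ‖gradient u x‖ ^ 2) * hessBil u x (gradient u x) (gradient u x) := by
      rw [hessBil, map_smul, real_inner_smul_left, hessBil]
    have h2 := hg0 x hx
    have h3 : H' (u x, ‖gradient u x‖ ^ 2) *
        (g (u x, ‖gradient u x‖ ^ 2) * ‖gradient u x‖ ^ 2) ≤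
        (C * ε) * (2 * ‖gradient u x‖ ^ 2) := by
      have h4 := (le_abs_self _).trans (hH'b x hx)
      have h5 : C * ‖gradient u x‖ ^ 2 ≤ C * ε := mul_le_mul_of_nonneg_left (hq x hx) hC
      have h6 : 0 ≤ C * ε := (mul_nonneg hC (hq0 x)).trans h5
      exact mul_le_mul (h4.trans h5) (mul_le_mul_of_nonneg_right (hg2 x hx) (hq0 x))
        (mul_nonneg h2.le (hq0 x)) h6
    rw [h1]
    have h7 : f (u x, ‖gradient u x‖ ^ 2) / g (u x, ‖gradient u x‖ ^ 2) *
        (g (u x, ‖gradient u x‖ ^ 2) * hessBil u x (gradient u x) (gradient u x)) =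
        f (u x, ‖gradient u x‖ ^ 2) * hessBil u x (gradient u x) (gradient u x) := by
      field_simp
    linear_combination h7 + 1 / 2 * h3
  have hHG : ∫ x, H (u x, ‖gradient u x‖ ^ 2) * G x ∂ν ≤
      ∫ x, (G x * ‖gradient u x‖ ^ 2 + η * (|G x| * ‖gradient u x‖ ^ 2)) ∂ν := by
    refine hν.integral_mono (hφc.mul hG) (by fun_prop) fun x hx => ?_
    have h1 : (H (u x, ‖gradient u x‖ ^ 2) - ‖gradient u x‖ ^ 2) * G x ≤
        η * ‖gradient u x‖ ^ 2 * |G x| := by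
      refine (le_abs_self _).trans ?_
      rw [abs_mul]
      exact mul_le_mul_of_nonneg_right (hHb x hx) (abs_nonneg _)
    linear_combination h1
  rw [hν.integral_mul_divg_weightedGradient hu hg hφ,
    integral_add (hν.integrable (by fun_prop)) (hν.integrable (by fun_prop)),
    integral_const_mul] at hHG
  rw [integral_sub (hν.integrable (by fun_prop)) (hν.integrable (by fun_prop)),
    integral_const_mul, integral_const_mul] at hlow
  linear_combination hlow + 1 / 2 * hHG

/-- Replacing `|∇u|²` by the squared gradient of the high-frequency part in `∫ G |∇u|²`. -/
lemma IsSphereMeasure.abs_integral_divg_low_le (hν : IsSphereMeasure ν) (hu : IsSphereFun u)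
    (hu₁ : IsSphereFun u₁)
    (hg : ∀ x ∈ sphere (0 : Euc n) 1, ContDiffAt ℝ 1 g (u x, ‖gradient u x‖ ^ 2))
    {K K' : ℝ × ℝ → ℝ} {C ε B : ℝ} (hC : 0 ≤ C) (hK : ContDiff ℝ 1 K)
    (hK' : ∀ x ∈ sphere (0 : Euc n) 1, HasFDerivAt K
      (K' (u x, ‖gradient u x‖ ^ 2) • ContinuousLinearMap.fst ℝ ℝ ℝ +
        g (u x, ‖gradient u x‖ ^ 2) •
          ContinuousLinearMap.snd ℝ ℝ ℝ) (u x, ‖gradient u x‖ ^ 2))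
    (hK'b : ∀ x ∈ sphere (0 : Euc n) 1,
      |K' (u x, ‖gradient u x‖ ^ 2)| ≤ C * ‖gradient u x‖ ^ 2)
    (hKb : ∀ x ∈ sphere (0 : Euc n) 1,
      |K (u x, ‖gradient u x‖ ^ 2)| ≤ 2 * ‖gradient u x‖ ^ 2)
    (hg2 : ∀ x ∈ sphere (0 : Euc n) 1, |g (u x, ‖gradient u x‖ ^ 2)| ≤ 2)
    (hq : ∀ x ∈ sphere (0 : Euc n) 1, ‖gradient u x‖ ^ 2 ≤ ε) (hε : 0 ≤ ε)
    (hB0 : 0 ≤ B) (hB : ∀ x ∈ sphere (0 : Euc n) 1, ‖fderiv ℝ (gradient u₁) x‖ ≤ B)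
    (hle : ∫ x, ‖gradient u₁ x‖ ^ 2 ∂ν ≤ ∫ x, ‖gradient u x‖ ^ 2 ∂ν) :
    |∫ x, divg (weightedGradient g u) x *
        (2 * ⟪gradient u₁ x, gradient u x⟫ - ‖gradient u₁ x‖ ^ 2) ∂ν| ≤
      ((2 * n + 8) * B + C * ε) * ∫ x, ‖gradient u x‖ ^ 2 ∂ν := by
  have hne {x : Euc n} (hx : x ∈ sphere (0 : Euc n) 1) : x ≠ 0 := ne_zero_of_mem_unit_sphere' hx
  have hd := hu.continuousOn_gradient
  have hd₁ := hu₁.continuousOn_gradient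
  have hl₁ := hu₁.continuousOn_lapl
  have hG := continuousOn_divg_weightedGradient hu hg
  have hp : ∀ x ∈ sphere (0 : Euc n) 1,
      ContDiffAt ℝ 1 (fun y => ⟪gradient u₁ y, gradient u y⟫) x :=
    fun x hx => hu₁.contDiffAt_inner_gradient hu (hne hx)
  have hq₁ : ∀ x ∈ sphere (0 : Euc n) 1,
      ContDiffAt ℝ 1 (fun y => ⟪gradient u₁ y, gradient u₁ y⟫) x :=
    fun x hx => hu₁.contDiffAt_inner_gradient hu₁ (hne hx)
  have hφ : ∀ x ∈ sphere (0 : Euc n) 1,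
      ContDiffAt ℝ 1 (fun y => K (u y, ‖gradient u y‖ ^ 2)) x :=
    fun x hx => hu.contDiffAt_comp (hne hx) hK.contDiffAt
  have hφc : ContinuousOn (fun y => K (u y, ‖gradient u y‖ ^ 2)) (sphere 0 1) :=
    fun x hx => (hφ x hx).continuousAt.continuousWithinAt
  have hφ₁ : ContinuousOn (fun x => fderiv ℝ (fun y => K (u y, ‖gradient u y‖ ^ 2)) x
      (gradient u₁ x)) (sphere 0 1) := fun x hx =>
    ((hφ x hx).continuousAt_fderiv_of_one.clm_apply
      (hu₁.differentiableAt_gradient (hne hx)).continuousAt).continuousWithinAt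
  have hpF := continuousOn_fderiv_weightedGradient hu hg hp
  have hq₁F := continuousOn_fderiv_weightedGradient hu hg hq₁
  set I := ∫ x, ‖gradient u x‖ ^ 2 ∂ν with hI
  have hmean : ∫ x, (‖gradient u x‖ ^ 2 + ‖gradient u₁ x‖ ^ 2) ∂ν ≤ 2 * I := by
    rw [integral_add (hν.integrable (by fun_prop)) (hν.integrable (by fun_prop))]
    linarith
  have hprod (x : Euc n) : ‖gradient u x‖ * ‖gradient u₁ x‖ ≤
      1 / 2 * (‖gradient u x‖ ^ 2 + ‖gradient u₁ x‖ ^ 2) := by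
    linarith [two_mul_le_add_sq ‖gradient u x‖ ‖gradient u₁ x‖]
  have hhess (x : Euc n) (c : ℝ) (v w : Euc n) : hessBil u₁ x (c • v) w = c * hessBil u₁ x v w := by
    rw [hessBil, map_smul, real_inner_smul_left, hessBil]
  have hquad : |∫ x, ⟪gradient u₁ x, gradient u₁ x⟫ * divg (weightedGradient g u) x ∂ν| ≤
      4 * B * I := by
    rw [hν.integral_mul_divg_weightedGradient hu hg hq₁, abs_neg]
    refine (hν.abs_integral_le (G := fun x => 2 * B * (‖gradient u x‖ ^ 2 + ‖gradient u₁ x‖ ^ 2))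
      hq₁F (by fun_prop) fun x hx => ?_).trans ?_
    · rw [hu₁.fderiv_inner_gradient hu₁ (hne hx), weightedGradient, hhess, ← two_mul, abs_mul,
        abs_mul, abs_two]
      have h1 := abs_hessBil_le (hB x hx) (gradient u x) (gradient u₁ x)
      have h2 := h1.trans (mul_le_mul_of_nonneg_left (hprod x) hB0)
      have h3 := mul_le_mul (hg2 x hx) h2 (abs_nonneg _) zero_le_two
      linear_combination 2 * h3
    · rw [integral_const_mul]
      linear_combination 2 * B * hmean
  have hcross : |∫ x, ⟪gradient u₁ x, gradient u x⟫ * divg (weightedGradient g u) x ∂ν| ≤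
      ((n + 2) * B + C * ε / 2) * I := by
    have hrest : |∫ x, (fderiv ℝ (fun y => ⟪gradient u₁ y, gradient u y⟫) x
        (weightedGradient g u x) - 1 / 2 * fderiv ℝ (fun y => K (u y, ‖gradient u y‖ ^ 2)) x
          (gradient u₁ x)) ∂ν| ≤ (2 * B + C * ε / 2) * I := by
      refine (hν.abs_integral_le (G := fun x => 2 * B * ‖gradient u x‖ ^ 2 +
        C * ε / 4 * (‖gradient u x‖ ^ 2 + ‖gradient u₁ x‖ ^ 2))
        (by fun_prop) (by fun_prop) fun x hx => ?_).trans ?_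
      · have h0 : fderiv ℝ (fun y => ⟪gradient u₁ y, gradient u y⟫) x (weightedGradient g u x) -
            1 / 2 * fderiv ℝ (fun y => K (u y, ‖gradient u y‖ ^ 2)) x (gradient u₁ x) =
            g (u x, ‖gradient u x‖ ^ 2) * hessBil u₁ x (gradient u x) (gradient u x) -
              1 / 2 * (K' (u x, ‖gradient u x‖ ^ 2) * ⟪gradient u x, gradient u₁ x⟫) := by
          have h1 : hessBil u x (g (u x, ‖gradient u x‖ ^ 2) • gradient u x) (gradient u₁ x) =
              g (u x, ‖gradient u x‖ ^ 2) * hessBil u x (gradient u₁ x) (gradient u x) := by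
            rw [hu.hessBil_symm (hne hx) (gradient u₁ x), hessBil, map_smul,
              real_inner_smul_left, hessBil]
          rw [hu₁.fderiv_inner_gradient hu (hne hx), hu.fderiv_comp (hne hx) (hK' x hx),
            weightedGradient, hhess, h1]
          ring
        rw [h0]
        refine (abs_sub _ _).trans (add_le_add ?_ ?_)
        · rw [abs_mul]
          have h1 := mul_le_mul (hg2 x hx) (abs_hessBil_le (hB x hx) (gradient u x)
            (gradient u x)) (abs_nonneg _) zero_le_two
          linear_combination h1
        · rw [abs_mul, abs_mul, abs_of_pos (one_half_pos (α := ℝ))]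
          have h1 := (hK'b x hx).trans (mul_le_mul_of_nonneg_left (hq x hx) hC)
          have h2 := mul_le_mul h1 ((abs_real_inner_le_norm (gradient u x)
            (gradient u₁ x)).trans (hprod x)) (abs_nonneg _) (mul_nonneg hC hε)
          linear_combination 1 / 2 * h2
      · rw [integral_add (hν.integrable (by fun_prop)) (hν.integrable (by fun_prop)),
          integral_const_mul, integral_const_mul]
        linear_combination C * ε / 4 * hmean
    have hmain : |∫ x, fderiv ℝ (fun y => K (u y, ‖gradient u y‖ ^ 2)) x (gradient u₁ x) ∂ν| ≤
        2 * n * B * I := by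
      rw [← abs_neg, ← hν.integral_mul_divg hφ
        (fun x hx => hu₁.contDiffAt_gradient_one (hne hx)) fun y hy => hu₁.inner_gradient_self hy,
        ← integral_const_mul]
      refine hν.abs_integral_le (hφc.mul hl₁) (by fun_prop) fun x hx => ?_
      rw [abs_mul]
      have h1 := mul_le_mul (hKb x hx) (abs_lapl_le (hB x hx)) (abs_nonneg _) (by positivity)
      refine h1.trans_eq ?_
      ring
    rw [integral_sub (hν.integrable hpF) (hν.integrable (by fun_prop)),
      integral_const_mul] at hrest
    rw [hν.integral_mul_divg_weightedGradient hu hg hp, abs_neg]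
    rw [abs_le] at hrest hmain ⊢
    constructor
    · linear_combination hrest.1 + 1 / 2 * hmain.1
    · linear_combination hrest.2 + 1 / 2 * hmain.2
  have hsplit : ∫ x, divg (weightedGradient g u) x *
        (2 * ⟪gradient u₁ x, gradient u x⟫ - ‖gradient u₁ x‖ ^ 2) ∂ν =
      2 * (∫ x, ⟪gradient u₁ x, gradient u x⟫ * divg (weightedGradient g u) x ∂ν) -
        ∫ x, ⟪gradient u₁ x, gradient u₁ x⟫ * divg (weightedGradient g u) x ∂ν := by
    rw [← integral_const_mul,
      ← integral_sub (hν.integrable (by fun_prop)) (hν.integrable (by fun_prop))]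
    refine hν.integral_congr fun x _ => ?_
    rw [real_inner_self_eq_norm_sq]
    ring
  rw [hsplit]
  rw [abs_le] at hquad hcross ⊢
  constructor
  · linear_combination hquad.2 + 2 * hcross.1
  · linear_combination hquad.1 + 2 * hcross.2

end WeightedGradient

set_option maxHeartbeats 2000000 in
/-- The frequency decomposition bound for the uncurried weights and an arbitrary non-zero
rotation-invariant measure on the sphere. -/
lemma IsSphereMeasure.exists_cubic_bound {n : ℕ} (hn : 2 ≤ n) {ν : Measure (Euc n)}
    (hν : IsSphereMeasure ν) (h0 : ν ≠ 0) {O : Set (ℝ × ℝ)} (hO : IsOpen O)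
    (hO0 : (0 : ℝ × ℝ) ∈ O) {f g : ℝ × ℝ → ℝ} (hf : ContDiffOn ℝ 1 f O)
    (hg : ContDiffOn ℝ 1 g O) (hgpos : ∀ p ∈ O, 0 < g p) (hf0 : f 0 = 1) (hg0 : g 0 = 1)
    (lam : ℝ) {δ : ℝ} (hδ : 0 < δ) :
    ∃ ε₀ : ℝ, 0 < ε₀ ∧ ∀ ε : ℝ, 0 < ε → ε < ε₀ → ∀ u u₁ u₂ : Euc n → ℝ,
      IsSphereFun u → IsSphereFun u₁ → IsSphereFun u₂ →
      (∀ x : Euc n, x ≠ 0 → u x = u₁ x + u₂ x) →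
      (∀ x ∈ sphere (0 : Euc n) 1, |u x| ≤ ε ∧ ‖gradient u x‖ ≤ ε) →
      IsLowFrequency lam u₁ →
      (∀ φ μ, IsSphereEigenfun φ μ → μ ≤ lam → ∫ x, u₂ x * φ x ∂ν = 0) →
      -(1 / 2) * (∫ x, divg (weightedGradient g u) x * ‖gradient u₂ x‖ ^ 2 ∂ν)
        - δ * ((∫ x, |divg (weightedGradient g u) x| * ‖gradient u₂ x‖ ^ 2 ∂ν)
          + ∫ x, (max (divg (weightedGradient g u) x) 0 + 1) * ‖gradient u x‖ ^ 2 ∂ν) ≤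
      ∫ x, f (u x, ‖gradient u x‖ ^ 2) * hessBil u x (gradient u x) (gradient u x) ∂ν := by
  have hfin := hν.finite
  obtain ⟨C₀, hC₀, hhess⟩ := hν.exists_hess_bound_of_isLowFrequency hn h0 lam
  obtain ⟨C₁, H, H', hC₁, hH, hHr⟩ := exists_primitive (k := fun p => f p / g p) hO hO0
    (hf.div hg fun p hp => (hgpos p hp).ne') (by rw [hf0, hg0, div_one])
  obtain ⟨C₂, K, K', hC₂, hK, hKr⟩ := exists_primitive hO hO0 hg hg0
  obtain ⟨ρ, hρ, hρO⟩ := Metric.isOpen_iff.1 hO 0 hO0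
  obtain ⟨η, hη, hηδ, hη1⟩ : ∃ η : ℝ, 0 < η ∧ η ≤ δ / 2 ∧ η ≤ 1 :=
    ⟨min (δ / 2) 1, lt_min (by linarith) one_pos, min_le_left _ _, min_le_right _ _⟩
  obtain ⟨r₁, hr₁, hHr⟩ := hHr η hη
  obtain ⟨r₂, hr₂, hKr⟩ := hKr 1 one_pos
  set m := √(ν.real univ)
  have hm : 0 ≤ m := Real.sqrt_nonneg _
  set M := (2 * n + 8) * (C₀ * m) + C₂ + C₁ + 1 with hM
  have hM1 : 0 ≤ (2 * n + 8) * (C₀ * m) := by positivity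
  have hM0 : 0 < M := by linarith
  refine ⟨min (min (η / M) 1) (min (min r₁ r₂) ρ), by positivity, ?_⟩
  intro ε hε hεε u u₁ u₂ hu hu₁ hu₂ hsum hsmall hlow hhigh
  simp only [lt_min_iff] at hεε
  obtain ⟨⟨hεM, hε1⟩, ⟨hεr₁, hεr₂⟩, hερ⟩ := hεε
  rw [lt_div_iff₀ hM0] at hεM
  have hq : ∀ x ∈ sphere (0 : Euc n) 1, ‖gradient u x‖ ^ 2 ≤ ε := fun x hx =>
    calc ‖gradient u x‖ ^ 2 ≤ ε ^ 2 := by gcongr; exact (hsmall x hx).2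
      _ ≤ ε := by nlinarith
  have hP {r : ℝ} (hr : ε < r) {x : Euc n} (hx : x ∈ sphere (0 : Euc n) 1) :
      (u x, ‖gradient u x‖ ^ 2) ∈ ball (0 : ℝ × ℝ) r := by
    rw [mem_ball_zero_iff, Prod.norm_def, max_lt_iff, Real.norm_eq_abs, Real.norm_eq_abs, abs_sq]
    exact ⟨(hsmall x hx).1.trans_lt hr, (hq x hx).trans_lt hr⟩
  have hPO {x : Euc n} (hx : x ∈ sphere (0 : Euc n) 1) : O ∈ nhds (u x, ‖gradient u x‖ ^ 2) :=
    hO.mem_nhds (hρO (hP hερ hx))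
  have hgc : ∀ x ∈ sphere (0 : Euc n) 1, ContDiffAt ℝ 1 g (u x, ‖gradient u x‖ ^ 2) :=
    fun x hx => hg.contDiffAt (hPO hx)
  have hg2 : ∀ x ∈ sphere (0 : Euc n) 1, |g (u x, ‖gradient u x‖ ^ 2)| ≤ 2 := fun x hx => by
    have h1 := (hKr _ (hP hεr₂ hx)).2.2.1
    have h2 := abs_le.1 h1
    exact abs_le.2 ⟨by linarith, by linarith⟩
  have hcubic := hν.integral_cubic_ge hu hgc hC₁ hH
    (fun x hx => (hf.contDiffAt (hPO hx)).continuousAt)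
    (fun x hx => (hHr _ (hP hεr₁ hx)).1)
    (fun x hx => by simpa only [abs_sq] using (hHr _ (hP hεr₁ hx)).2.1)
    (fun x hx => by simpa only [abs_sq] using (hHr _ (hP hεr₁ hx)).2.2.2)
    (fun x hx => hgpos _ (hρO (hP hερ hx)))
    (fun x hx => (le_abs_self _).trans (hg2 x hx)) hq
  obtain ⟨hle0, hle1⟩ := hν.integral_low_le hu₁ hu₂ hsum hlow hhigh
  have hL2 : √(∫ x, u₁ x ^ 2 ∂ν) ≤ ε * m := by
    rw [Real.sqrt_le_left (by positivity), mul_pow, Real.sq_sqrt measureReal_nonneg]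
    refine hle0.trans ((hν.integral_mono (hu.continuousOn.pow 2)
      (continuousOn_const (c := ε ^ 2)) fun x hx => ?_).trans_eq ?_)
    · exact sq_le_sq' (abs_le.1 (hsmall x hx).1).1 (abs_le.1 (hsmall x hx).1).2
    · simp [mul_comm]
  have hB : ∀ x ∈ sphere (0 : Euc n) 1, ‖fderiv ℝ (gradient u₁) x‖ ≤ C₀ * (ε * m) :=
    fun x hx => (hhess u₁ hlow x hx).trans (by gcongr)
  have herr := hν.abs_integral_divg_low_le hu hu₁ hgc hC₂ hK
    (fun x hx => (hKr _ (hP hεr₂ hx)).1)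
    (fun x hx => by simpa only [abs_sq] using (hKr _ (hP hεr₂ hx)).2.1)
    (fun x hx => by
      have h1 := (hKr _ (hP hεr₂ hx)).2.2.2
      simp only [abs_sq] at h1
      have h2 := abs_le.1 h1
      have h3 := sq_nonneg ‖gradient u x‖
      exact abs_le.2 ⟨by linarith, by linarith⟩)
    hg2 hq hε.le (by positivity) hB hle1
  set G := divg (weightedGradient g u)
  have hG : ContinuousOn G (sphere 0 1) := continuousOn_divg_weightedGradient hu hgc
  have hd := hu.continuousOn_gradient
  have hd₁ := hu₁.continuousOn_gradient
  have hd₂ := hu₂.continuousOn_gradient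
  set I := ∫ x, ‖gradient u x‖ ^ 2 ∂ν
  have hI : 0 ≤ I := integral_nonneg fun x => sq_nonneg _
  have hE : (∫ x, G x * ‖gradient u x‖ ^ 2 ∂ν) - (∫ x, G x * ‖gradient u₂ x‖ ^ 2 ∂ν) =
      ∫ x, G x * (2 * ⟪gradient u₁ x, gradient u x⟫ - ‖gradient u₁ x‖ ^ 2) ∂ν := by
    rw [← integral_sub (hν.integrable (by fun_prop)) (hν.integrable (by fun_prop))]
    refine hν.integral_congr fun x hx => ?_
    have h1 : gradient u₂ x = gradient u x - gradient u₁ x := by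
      rw [gradient_eq_add hu₁ hu₂ hsum (ne_zero_of_mem_unit_sphere' hx), add_sub_cancel_left]
    rw [h1, norm_sub_sq_real, real_inner_comm]
    ring
  rw [← hE] at herr
  have herr' : |(∫ x, G x * ‖gradient u x‖ ^ 2 ∂ν) - (∫ x, G x * ‖gradient u₂ x‖ ^ 2 ∂ν)| ≤
      η * I := by
    refine herr.trans (mul_le_mul_of_nonneg_right ?_ hI)
    nlinarith
  have hmax : ContinuousOn (fun x => max (G x) 0) (sphere 0 1) := hG.sup continuousOn_const
  have habs : ∫ x, |G x| * ‖gradient u x‖ ^ 2 ∂ν =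
      2 * (∫ x, max (G x) 0 * ‖gradient u x‖ ^ 2 ∂ν) - ∫ x, G x * ‖gradient u x‖ ^ 2 ∂ν := by
    rw [← integral_const_mul,
      ← integral_sub (hν.integrable (by fun_prop)) (hν.integrable (by fun_prop))]
    refine hν.integral_congr fun x _ => ?_
    rcases le_total 0 (G x) with h | h
    · rw [abs_of_nonneg h, max_eq_left h]; ring
    · rw [abs_of_nonpos h, max_eq_right h]; ring
  have hhigh_abs : -(∫ x, G x * ‖gradient u₂ x‖ ^ 2 ∂ν) ≤
      ∫ x, |G x| * ‖gradient u₂ x‖ ^ 2 ∂ν := by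
    rw [← integral_neg]
    refine hν.integral_mono (by fun_prop) (by fun_prop) fun x _ => ?_
    rw [← neg_mul]
    gcongr
    exact neg_le_abs _
  have hplus : ∫ x, (max (G x) 0 + 1) * ‖gradient u x‖ ^ 2 ∂ν =
      (∫ x, max (G x) 0 * ‖gradient u x‖ ^ 2 ∂ν) + I := by
    rw [← integral_add (hν.integrable (by fun_prop)) (hν.integrable (by fun_prop))]
    exact hν.integral_congr fun x _ => by ring
  have hJ : 0 ≤ ∫ x, max (G x) 0 * ‖gradient u x‖ ^ 2 ∂ν := integral_nonneg fun x => by positivity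
  have hJ₂ : 0 ≤ ∫ x, |G x| * ‖gradient u₂ x‖ ^ 2 ∂ν := integral_nonneg fun x => by positivity
  rw [hplus]
  rw [habs] at hcubic
  set a := ∫ x, G x * ‖gradient u x‖ ^ 2 ∂ν
  set b := ∫ x, G x * ‖gradient u₂ x‖ ^ 2 ∂ν
  set J := ∫ x, max (G x) 0 * ‖gradient u x‖ ^ 2 ∂ν
  set J₂ := ∫ x, |G x| * ‖gradient u₂ x‖ ^ 2 ∂ν
  have hab := abs_le.1 herr'
  have h1 : η / 2 * (2 * J - a) ≤ η / 2 * (2 * J + J₂ + η * I) :=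
    mul_le_mul_of_nonneg_left (by linarith [hab.1]) (by positivity)
  have h2 : C₁ * ε * I ≤ η * I := mul_le_mul_of_nonneg_right (by nlinarith) hI
  have h3 : η * (η * I) ≤ η * I := mul_le_of_le_one_left (by positivity) hη1
  have h4 := mul_le_mul_of_nonneg_right hηδ hI
  have h5 := mul_le_mul_of_nonneg_right hηδ hJ
  have h6 := mul_le_mul_of_nonneg_right hηδ hJ₂
  have h7 := mul_nonneg hδ.le hJ
  have h8 := mul_nonneg hδ.le hJ₂
  have h9 := mul_nonneg hδ.le hI
  nlinarith [hab.1, hab.2]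

/-- Let `n ≥ 3`, let `0 ∈ U ⊆ ℝ` be open with `B(0, r̄) ⊆ U`, let
`f, g : U × U → (0, ∞)` be `C¹` with `f(0,0) = g(0,0) = 1`, and fix `λ > 0`. For every
`δ > 0` there is `ε₀ > 0` such that for every smooth `u : S^{n-1} → (−1, ∞)` with
`‖u‖_{C¹} ≤ ε` for some `ε < min(ε₀, r̄)`, writing `u = u₁ + u₂` with `u₁` (resp. `u₂`) the
`L²` projection of `u` on the span of the eigenfunctions of `−Δ` with eigenvalue `≤ λ`
(resp. `> λ`), one has
`∫ f(u,|∇u|²) ∇²u[∇u,∇u] ≥ −(1/2) ∫ div(g(u,|∇u|²)∇u) |∇u₂|²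
  − δ (∫ |div(g(u,|∇u|²)∇u)|·|∇u₂|² + ∫ ([div(g(u,|∇u|²)∇u)]⁺ + 1)|∇u|²)`. -/
theorem frequency_decomposition_cubic_bound (n : ℕ) (hn : 3 ≤ n)
    (U : Set ℝ) (hUopen : IsOpen U) (hU0 : (0 : ℝ) ∈ U)
    (rbar : ℝ) (hrbar : 0 < rbar) (hball : Metric.ball (0 : ℝ) rbar ⊆ U)
    (f g : ℝ → ℝ → ℝ)
    (hf : ContDiffOn ℝ 1 (fun p : ℝ × ℝ => f p.1 p.2) (U ×ˢ U))
    (hg : ContDiffOn ℝ 1 (fun p : ℝ × ℝ => g p.1 p.2) (U ×ˢ U))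
    (hfpos : ∀ s ∈ U, ∀ t ∈ U, 0 < f s t) (hgpos : ∀ s ∈ U, ∀ t ∈ U, 0 < g s t)
    (hf00 : f 0 0 = 1) (hg00 : g 0 0 = 1)
    (lam : ℝ) (hlam : 0 < lam) (δ : ℝ) (hδ : 0 < δ) :
    ∃ ε₀ : ℝ, 0 < ε₀ ∧ ∀ ε : ℝ, 0 < ε → ε < min ε₀ rbar →
      ∀ u u₁ u₂ : Euc n → ℝ,
        IsSphereFun u → IsSphereFun u₁ → IsSphereFun u₂ →
        (∀ x : Euc n, -1 < u x) →
        (∀ x : Euc n, x ≠ 0 → u x = u₁ x + u₂ x) →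
        (∀ x ∈ sphere (0 : Euc n) 1, |u x| ≤ ε ∧ ‖gradient u x‖ ≤ ε) →
        IsLowFrequency lam u₁ → IsHighFrequency lam u₂ →
        (∫ x in sphere (0 : Euc n) 1,
            f (u x) (‖gradient u x‖ ^ 2)
              * hessBil u x (gradient u x) (gradient u x) ∂μH[(n : ℝ) - 1])
          ≥ -(1 / 2) * (∫ x in sphere (0 : Euc n) 1,
                divg (fun y => g (u y) (‖gradient u y‖ ^ 2) • gradient u y) x
                  * ‖gradient u₂ x‖ ^ 2 ∂μH[(n : ℝ) - 1])
            - δ * ((∫ x in sphere (0 : Euc n) 1,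
                  |divg (fun y => g (u y) (‖gradient u y‖ ^ 2) • gradient u y) x|
                    * ‖gradient u₂ x‖ ^ 2 ∂μH[(n : ℝ) - 1])
                + ∫ x in sphere (0 : Euc n) 1,
                    (max (divg (fun y => g (u y) (‖gradient u y‖ ^ 2) • gradient u y) x) 0
                        + 1)
                      * ‖gradient u x‖ ^ 2 ∂μH[(n : ℝ) - 1]) := by
  by_cases h0 : (μH[(n : ℝ) - 1] : Measure (Euc n)).restrict (sphere 0 1) = 0
  · exact ⟨1, one_pos, fun _ _ _ _ _ _ _ _ _ _ _ _ _ _ => by rw [h0]; simp⟩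
  · obtain ⟨ε₀, hε₀, h⟩ := (isSphereMeasure_hausdorff (by omega : 1 ≤ n)).exists_cubic_bound
      (by omega) h0 (hUopen.prod hUopen) ⟨hU0, hU0⟩ hf hg
      (fun p hp => hgpos p.1 hp.1 p.2 hp.2) hf00 hg00 lam hδ
    exact ⟨ε₀, hε₀, fun ε hε hεε u u₁ u₂ hu hu₁ hu₂ _ hsum hsmall hlow hhigh =>
      h ε hε (lt_min_iff.1 hεε).1 u u₁ u₂ hu hu₁ hu₂ hsum hsmall hlow hhigh⟩
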